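/- arXiv:1606.01107 — 5 statements merged into one kernel-verified Lean document; each statement's English description precedes it below -/
import Mathlib

section
/- For every generalized theta graph Θ = Θ_{ℓ1,…,ℓp} with p ≥ 2, the packing chromatic number satisfies χρ(Θ) ≤ max{5, n_3 + 2}, where n_3 is the number of indices i with ℓ_i = 3. -/
/-- A packing `k`-coloring of an undirected graph `G`: colors lie in `{1,…,k}` and
two distinct vertices sharing color `i` are at distance greater than `i`. -/
def IsPackingColoring {V : Type*} (G : SimpleGraph V) (k : ℕ) (π : V → ℕ) : Prop :=
  (∀ x, 1 ≤ π x ∧ π x ≤ k) ∧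
  ∀ x y : V, x ≠ y → π x = π y → (π x : ℕ∞) < G.edist x y

/-- The packing chromatic number of an undirected graph. -/
noncomputable def packingChromaticNumber {V : Type*} (G : SimpleGraph V) : ℕ :=
  sInf {k | ∃ π : V → ℕ, IsPackingColoring G k π}

/-- Vertices of the generalized theta graph `Θ_{ℓ 0, …, ℓ (p-1)}`:
`Sum.inl false` is the end-vertex `u`, `Sum.inl true` is the end-vertex `v`, and
`Sum.inr ⟨i, j⟩` is the internal vertex `x_i^{j+1}` of the `i`-th path. -/
def ThetaVert (p : ℕ) (ℓ : Fin p → ℕ) : Type :=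
  Bool ⊕ (Σ i : Fin p, Fin (ℓ i - 1))

/-- Base relation generating the edges of the generalized theta graph. -/
def thetaRel (p : ℕ) (ℓ : Fin p → ℕ) : ThetaVert p ℓ → ThetaVert p ℓ → Prop
  | Sum.inl a, Sum.inl b => a = false ∧ b = true ∧ ∃ i, ℓ i = 1
  | Sum.inl a, Sum.inr ⟨i, j⟩ =>
      (a = false ∧ (j : ℕ) = 0) ∨ (a = true ∧ (j : ℕ) + 2 = ℓ i)
  | Sum.inr ⟨i, j⟩, Sum.inr ⟨i', j'⟩ => (i : ℕ) = (i' : ℕ) ∧ (j : ℕ) + 1 = (j' : ℕ)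
  | Sum.inr _, Sum.inl _ => False

/-- The generalized theta graph `Θ_{ℓ 0, …, ℓ (p-1)}`. -/
def thetaGraph (p : ℕ) (ℓ : Fin p → ℕ) : SimpleGraph (ThetaVert p ℓ) :=
  SimpleGraph.fromRel (thetaRel p ℓ)

/-- The end-vertex `u` of the generalized theta graph. -/
def thetaU (p : ℕ) (ℓ : Fin p → ℕ) : ThetaVert p ℓ := Sum.inl false

/-- The end-vertex `v` of the generalized theta graph. -/
def thetaV (p : ℕ) (ℓ : Fin p → ℕ) : ThetaVert p ℓ := Sum.inl true

/-- `pathCount p ℓ m` is `n_m`, the number of paths of length `m`. -/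
def pathCount (p : ℕ) (ℓ : Fin p → ℕ) (m : ℕ) : ℕ :=
  (Finset.univ.filter (fun i : Fin p => ℓ i = m)).card

/-- `longPathCount p ℓ` is `Σ_{i ≥ 3} n_i`, the number of paths of length at least `3`. -/
def longPathCount (p : ℕ) (ℓ : Fin p → ℕ) : ℕ :=
  (Finset.univ.filter (fun i : Fin p => 3 ≤ ℓ i)).card

/-- Conditions (A)–(N) on the multiset of path lengths of a generalized theta graph. -/
def CondAN (p : ℕ) (ℓ : Fin p → ℕ) : Prop :=
  let n := pathCount p ℓ
  -- (A)
  (n 1 = 0 ∧ n 2 = 0 ∧ n 3 = 0 ∧ n 4 = 0) ∨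
  -- (B)
  (n 1 = 0 ∧ n 2 = 0 ∧ n 3 = 0 ∧ n 5 ≤ 2 ∧ n 5 + n 6 ≤ 4) ∨
  -- (C)
  (n 1 = 0 ∧ n 2 = 0 ∧ n 3 = 0 ∧ n 7 ≤ 1) ∨
  -- (D)
  (n 1 = 0 ∧ n 2 = 0 ∧ n 3 = 0 ∧ n 5 + n 6 + n 7 ≤ 2) ∨
  -- (E)
  (n 1 = 0 ∧ n 2 = 0 ∧ n 3 ≤ 1 ∧ n 5 = 0 ∧ n 6 = 0 ∧ n 7 = 0) ∨
  -- (F)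
  (n 1 = 0 ∧ n 2 = 0 ∧ n 3 ≤ 1 ∧ n 4 = 0 ∧ n 7 + n 8 ≤ 1) ∨
  -- (G)
  (n 1 = 0 ∧ n 3 = 0 ∧ n 4 = 0 ∧ n 7 ≤ 1 ∧ n 8 = 0) ∨
  -- (H)
  (n 1 = 0 ∧ n 3 ≤ 2 ∧ (n 5 = 0 ∨ n 5 + n 6 ≤ 1)) ∨
  -- (I)
  (n 1 = 0 ∧ n 3 + n 4 + n 5 ≤ 1) ∨
  -- (J)
  (n 1 ≤ 1 ∧ n 3 ≤ 2 ∧ n 5 = 0 ∧ n 6 = 0) ∨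
  -- (K)
  (n 1 ≤ 1 ∧ n 3 = 0 ∧ n 7 = 0) ∨
  -- (L)
  (n 1 ≤ 1 ∧ n 3 = 0 ∧ n 4 = 0 ∧ n 7 ≤ 1 ∧ n 8 = 0) ∨
  -- (M)
  (n 1 ≤ 1 ∧ n 3 ≤ 1 ∧ n 4 = 0 ∧ n 7 = 0 ∧ n 8 = 0) ∨
  -- (N)
  (n 1 ≤ 1 ∧ longPathCount p ℓ ≤ 1)

/-- `DirPath A m x y` holds when there is a directed walk of length `m`
from `x` to `y` following the arc relation `A`. -/
def DirPath {V : Type*} (A : V → V → Prop) : ℕ → V → V → Prop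
  | 0, x, y => x = y
  | m + 1, x, y => ∃ z, A x z ∧ DirPath A m z y

/-- The weak directed distance between `x` and `y`: the number of arcs in a shortest
directed path linking `x` and `y`, in either direction (`⊤` if none exists). -/
noncomputable def weakEDist {V : Type*} (A : V → V → Prop) (x y : V) : ℕ∞ :=
  sInf {n : ℕ∞ | ∃ m : ℕ, (DirPath A m x y ∨ DirPath A m y x) ∧ n = (m : ℕ∞)}

/-- A packing `k`-coloring of an oriented graph with arc relation `A`. -/
def IsDirPackingColoring {V : Type*} (A : V → V → Prop) (k : ℕ) (π : V → ℕ) : Prop :=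
  (∀ x, 1 ≤ π x ∧ π x ≤ k) ∧
  ∀ x y : V, x ≠ y → π x = π y → (π x : ℕ∞) < weakEDist A x y

/-- The packing chromatic number of an oriented graph with arc relation `A`. -/
noncomputable def dirPackingChromaticNumber {V : Type*} (A : V → V → Prop) : ℕ :=
  sInf {k | ∃ π : V → ℕ, IsDirPackingColoring A k π}

/-- `A` is an orientation of the undirected graph `G`: every edge of `G` receives
exactly one of its two possible directions. -/
def IsOrientation {V : Type*} (G : SimpleGraph V) (A : V → V → Prop) : Prop :=
  (∀ x y : V, G.Adj x y ↔ (A x y ∨ A y x)) ∧ (∀ x y : V, A x y → ¬ A y x)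


/-- Colour of the internal vertex at position `q` of a path of length `L`; `t` is the rank of the
path among those of length `3`. -/
def thCol (L t q : ℕ) : ℕ :=
  if L = 3 then
    if q = 1 then (if t = 0 then 2 else if t = 1 then 1 else if t = 2 then 3 else t + 3)
    else (if t = 1 then 2 else 1)
  else if L % 2 = 0 then
    if q % 2 = 1 then 1 else if q % 4 = 2 then 2 else 3
  else
    if q = 1 then 1 else if q = 2 then 2 else if q % 2 = 0 then 1
    else if q % 4 = 1 then 2 else 3

/-- Lower bound for the distance to `u`. -/
def thA (L q : ℕ) : ℕ := min q (L - q + 1)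

/-- Lower bound for the distance to `v`. -/
def thB (L q : ℕ) : ℕ := min (q + 1) (L - q)

/-- Lower bound for the distance between two vertices of the same path. -/
def thG (L q r : ℕ) : ℕ := min ((q - r) + (r - q)) (min (r + 1 + (L - q)) (q + 1 + (L - r)))

theorem thCol_same (L t q r : ℕ) (hq : 1 ≤ q) (hr : 1 ≤ r) (hqL : q < L) (hrL : r < L)
    (hne : q ≠ r) (h : thCol L t q = thCol L t r) : thCol L t q < thG L q r := by
  unfold thG
  unfold thCol at *
  split_ifs at * <;> omega

set_option maxHeartbeats 2000000 in
theorem thCol_key (L t q : ℕ) (h1 : 1 ≤ q) (h2 : q < L) :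
    (thCol L t q = 1) ∨
    (thCol L t q = 2 ∧ ((L = 3 ∧ (t = 0 ∧ q = 1 ∨ t = 1 ∧ q = 2)) ∨ (2 ≤ q ∧ q + 2 ≤ L))) ∨
    (thCol L t q = 3 ∧ ((L = 3 ∧ t = 2 ∧ q = 1) ∨ (3 ≤ q ∧ q + 2 ≤ L))) ∨
    (thCol L t q = t + 3 ∧ 3 ≤ t ∧ L = 3) := by
  unfold thCol
  split_ifs <;> omega

theorem thCol_diff (L t q L' t' r : ℕ) (hq : 1 ≤ q) (hr : 1 ≤ r) (hqL : q < L) (hrL : r < L')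
    (hne : L = 3 → L' = 3 → t ≠ t') (h : thCol L t q = thCol L' t' r) :
    thCol L t q < min (thA L q + thA L' r) (thB L q + thB L' r) := by
  have h1 := thCol_key L t q hq hqL
  have h2 := thCol_key L' t' r hr hrL
  unfold thA thB
  rcases h1 with h1 | ⟨h1, h1'⟩ | ⟨h1, h1'⟩ | ⟨h1, h1'⟩ <;>
  rcases h2 with h2 | ⟨h2, h2'⟩ | ⟨h2, h2'⟩ | ⟨h2, h2'⟩ <;>
  rw [h1] <;> omega

theorem thCol_bound (L t q n : ℕ) (h : L = 3 → t < n) :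
    1 ≤ thCol L t q ∧ thCol L t q ≤ max 5 (n + 2) ∧ thCol L t q ≠ 4 ∧ thCol L t q ≠ 5 := by
  unfold thCol
  split_ifs <;> omega

/-- The colouring. -/
def thPi (p : ℕ) (ℓ t : Fin p → ℕ) : ThetaVert p ℓ → ℕ
  | Sum.inl a => if a = false then 4 else 5
  | Sum.inr ⟨i, j⟩ => thCol (ℓ i) (t i) ((j : ℕ) + 1)

/-- A `1`-Lipschitz potential vanishing at position `q` of path `i`. -/
def thPot (p : ℕ) (ℓ : Fin p → ℕ) (i : Fin p) (q : ℕ) : ThetaVert p ℓ → ℕ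
  | Sum.inl a => if a = false then thA (ℓ i) q else thB (ℓ i) q
  | Sum.inr ⟨i', j⟩ =>
      if i' = i then thG (ℓ i) q ((j : ℕ) + 1)
      else min (thA (ℓ i) q + thA (ℓ i') ((j : ℕ) + 1)) (thB (ℓ i) q + thB (ℓ i') ((j : ℕ) + 1))

theorem thPot_rel (p : ℕ) (ℓ : Fin p → ℕ) (i : Fin p) (q : ℕ) (hq : 1 ≤ q) (hqL : q < ℓ i)
    (x y : ThetaVert p ℓ) (h : thetaRel p ℓ x y) :
    thPot p ℓ i q x ≤ thPot p ℓ i q y + 1 ∧ thPot p ℓ i q y ≤ thPot p ℓ i q x + 1 := by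
  rcases x with a | ⟨i₁, j₁⟩ <;> rcases y with b | ⟨i₂, j₂⟩
  · obtain ⟨rfl, rfl, -⟩ := h
    simp only [thPot, thA, thB, if_true, Bool.true_eq_false, if_false]
    omega
  · have hj := j₂.2
    rcases h with ⟨rfl, h⟩ | ⟨rfl, h⟩
    · by_cases hi : i₂ = i
      · subst hi
        simp only [thPot, thA, thB, thG, if_true]
        omega
      · simp only [thPot, thA, thB, thG, if_true, if_neg hi]
        omega
    · by_cases hi : i₂ = i
      · subst hi
        simp only [thPot, thA, thB, thG, if_true, Bool.true_eq_false, if_false]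
        omega
      · simp only [thPot, thA, thB, thG, if_neg hi, Bool.true_eq_false, if_false]
        omega
  · exact h.elim
  · obtain ⟨h1, h2⟩ := h
    have h1 : i₁ = i₂ := Fin.ext h1
    subst h1
    have hj := j₂.2
    have hj' := j₁.2
    by_cases hi : i₁ = i
    · subst hi
      simp only [thPot, thA, thB, thG, if_true]
      omega
    · simp only [thPot, thA, thB, thG, if_neg hi]
      omega

theorem le_edist_of_lip {V : Type*} (G : SimpleGraph V) (f : V → ℕ)
    (hf : ∀ x y, G.Adj x y → f y ≤ f x + 1) (x y : V) (hx : f x = 0) :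
    (f y : ℕ∞) ≤ G.edist x y := by
  have hw : ∀ (a b : V) (w : G.Walk a b), f b ≤ f a + w.length := by
    intro a b w
    induction w with
    | nil => simp
    | cons h w ih =>
      have := hf _ _ h
      simp only [SimpleGraph.Walk.length_cons]
      omega
  unfold SimpleGraph.edist
  refine le_iInf fun w => ?_
  have := hw x y w
  rw [hx, Nat.zero_add] at this
  exact_mod_cast this

theorem stmt0 (p : ℕ) (ℓ : Fin p → ℕ) (hp : 2 ≤ p)
    (hmono : Monotone ℓ) (hpos : ∀ i, 1 ≤ ℓ i) (hsimple : 2 ≤ ℓ ⟨1, by omega⟩) :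
    packingChromaticNumber (thetaGraph p ℓ) ≤ max 5 (pathCount p ℓ 3 + 2) := by
  obtain ⟨t, ht, hinj⟩ : ∃ t : Fin p → ℕ, (∀ i, ℓ i = 3 → t i < pathCount p ℓ 3) ∧
      ∀ i i', ℓ i = 3 → ℓ i' = 3 → t i = t i' → i = i' := by
    let s := Finset.univ.filter (fun i : Fin p => ℓ i = 3)
    have hs : ∀ i, ℓ i = 3 → i ∈ s := fun i hi => by simp [s, hi]
    refine ⟨fun i => if h : i ∈ s then (s.equivFin ⟨i, h⟩ : ℕ) else 0, ?_, ?_⟩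
    · intro i hi
      simp only [dif_pos (hs i hi)]
      exact (s.equivFin ⟨i, hs i hi⟩).2
    · intro i i' hi hi' h
      simp only [dif_pos (hs i hi), dif_pos (hs i' hi')] at h
      have := s.equivFin.injective (Fin.ext h)
      simpa using this
  apply Nat.sInf_le
  refine ⟨thPi p ℓ t, ?_, ?_⟩
  · rintro (a | ⟨i, j⟩)
    · cases a <;> simp [thPi]
    · have := thCol_bound (ℓ i) (t i) ((j : ℕ) + 1) _ (ht i)
      exact ⟨this.1, this.2.1⟩
  · rintro (a | ⟨i, j⟩) (b | ⟨i', j'⟩) hne h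
    · exfalso
      cases a <;> cases b <;> first | exact hne rfl | simp [thPi] at h
    · exfalso
      have := thCol_bound (ℓ i') (t i') ((j' : ℕ) + 1) _ (ht i')
      simp only [thPi] at h
      split_ifs at h <;> omega
    · exfalso
      have := thCol_bound (ℓ i) (t i) ((j : ℕ) + 1) _ (ht i)
      simp only [thPi] at h
      split_ifs at h <;> omega
    · have hj := j.2
      have hj' := j'.2
      have hl : ∀ x y, (thetaGraph p ℓ).Adj x y →
          thPot p ℓ i ((j : ℕ) + 1) y ≤ thPot p ℓ i ((j : ℕ) + 1) x + 1 := by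
        intro x y hxy
        rcases hxy.2 with hr | hr
        · exact (thPot_rel p ℓ i _ (by omega) (by omega) _ _ hr).2
        · exact (thPot_rel p ℓ i _ (by omega) (by omega) _ _ hr).1
      refine lt_of_lt_of_le ?_ (le_edist_of_lip _ _ hl _ _ (by simp [thPot, thG]))
      rw [Nat.cast_lt]
      simp only [thPi] at h ⊢
      by_cases hi : i' = i
      · subst hi
        simp only [thPot, if_true]
        refine thCol_same _ _ _ _ (by omega) (by omega) (by omega) (by omega) ?_ h
        intro hjj
        apply hne
        have : j = j' := Fin.ext (by omega)
        rw [this]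
      · simp only [thPot, if_neg hi]
        refine thCol_diff _ _ _ _ _ _ (by omega) (by omega) (by omega) (by omega) ?_ h
        intro h3 h3' htt
        exact hi (hinj _ _ h3 h3' htt).symm
end

section
/- Let Θ = Θ_{ℓ1,…,ℓp} be a generalized theta graph with p ≥ 3 in which every path has length 3 (i.e., n_3 = p, so ℓ_i = 3 for all i). Then χρ(Θ) = p + 2. -/
namespace ThetaThree

/-- Path index of a vertex (`none` for the end-vertices). -/
def idx (p : ℕ) : ThetaVert p (fun _ => 3) → Option (Fin p)
  | Sum.inl _ => none
  | Sum.inr ⟨i, _⟩ => some i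

/-- Side of a vertex: `false` for the side of `u`, `true` for the side of `v`. -/
def side (p : ℕ) : ThetaVert p (fun _ => 3) → Bool
  | Sum.inl b => b
  | Sum.inr ⟨_, j⟩ => decide ((j : ℕ) = 1)

/-- End-vertices. -/
def E (p : ℕ) (b : Bool) : ThetaVert p (fun _ => 3) := Sum.inl b

/-- Internal vertices. -/
def I (p : ℕ) (b : Bool) (i : Fin p) : ThetaVert p (fun _ => 3) :=
  Sum.inr ⟨i, if b then (1 : Fin 2) else (0 : Fin 2)⟩

lemma cases_vert {p : ℕ} (x : ThetaVert p (fun _ => 3)) :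
    (∃ b, x = E p b) ∨ ∃ b i, x = I p b i := by
  rcases x with b | ⟨i, j⟩
  · exact Or.inl ⟨b, rfl⟩
  · right
    change Fin 2 at j
    fin_cases j
    · exact ⟨false, i, rfl⟩
    · exact ⟨true, i, rfl⟩

@[simp] lemma idx_E (p b) : idx p (E p b) = none := rfl
@[simp] lemma idx_I (p b i) : idx p (I p b i) = some i := rfl
@[simp] lemma side_E (p b) : side p (E p b) = b := rfl
@[simp] lemma side_I (p b i) : side p (I p b i) = b := by
  cases b <;> rfl
@[simp] lemma E_inj (p b c) : E p b = E p c ↔ b = c :=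
  ⟨fun h => by simpa using congrArg (side p) h, fun h => by rw [h]⟩
@[simp] lemma I_inj (p b c i j) : I p b i = I p c j ↔ b = c ∧ i = j :=
  ⟨fun h => ⟨by simpa using congrArg (side p) h, by simpa using congrArg (idx p) h⟩,
    fun h => by rw [h.1, h.2]⟩
@[simp] lemma E_ne_I (p b c i) : E p b ≠ I p c i := fun h => by
  simpa using congrArg (idx p) h
@[simp] lemma I_ne_E (p b c i) : I p c i ≠ E p b := fun h => by
  simpa using congrArg (idx p) h

lemma adj_EE (p b c) : ¬ (thetaGraph p (fun _ => 3)).Adj (E p b) (E p c) := by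
  rw [thetaGraph, SimpleGraph.fromRel_adj]
  simp [thetaRel, E]

lemma adj_EI (p b c i) : (thetaGraph p (fun _ => 3)).Adj (E p b) (I p c i) ↔ b = c := by
  rw [thetaGraph, SimpleGraph.fromRel_adj, and_iff_right (E_ne_I p b c i : E p b ≠ I p c i)]
  cases b <;> cases c <;> simp [thetaRel, E, I]

lemma adj_II (p b c i j) :
    (thetaGraph p (fun _ => 3)).Adj (I p b i) (I p c j) ↔ b ≠ c ∧ i = j := by
  rw [thetaGraph, SimpleGraph.fromRel_adj]
  cases b <;> cases c <;> simp [thetaRel, I, Fin.ext_iff] <;> grind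

lemma d1 {V : Type*} {G : SimpleGraph V} {x y : V} (h : G.Adj x y) : G.edist x y ≤ 1 :=
  (SimpleGraph.edist_eq_one_iff_adj.2 h).le

lemma d2 {V : Type*} {G : SimpleGraph V} {x z : V} (y : V) (h : G.Adj x y) (h' : G.Adj y z) :
    G.edist x z ≤ 2 :=
  (SimpleGraph.edist_triangle (v := y)).trans ((add_le_add (d1 h) (d1 h')).trans (by norm_num))

lemma d3 {V : Type*} {G : SimpleGraph V} {x w : V} (y z : V) (h : G.Adj x y) (h' : G.Adj y z)
    (h'' : G.Adj z w) : G.edist x w ≤ 3 :=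
  (SimpleGraph.edist_triangle (v := z)).trans
    ((add_le_add (d2 y h h') (d1 h'')).trans (by norm_num))

lemma adj_EI' (p b i) : (thetaGraph p (fun _ => 3)).Adj (E p b) (I p b i) :=
  (adj_EI ..).2 rfl
lemma adj_II' (p b i) : (thetaGraph p (fun _ => 3)).Adj (I p b i) (I p (!b) i) :=
  (adj_II ..).2 (by simp)

lemma one_le_two' : (1 : ℕ∞) ≤ 2 := by norm_num
lemma two_le_three' : (2 : ℕ∞) ≤ 3 := by norm_num

lemma edist_EI (p b c i) : (thetaGraph p (fun _ => 3)).edist (E p b) (I p c i) ≤ 2 := by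
  rcases eq_or_ne b c with rfl | h
  · exact (d1 (adj_EI' ..)).trans one_le_two'
  · obtain rfl : c = !b := by cases b <;> cases c <;> simp_all
    exact d2 (I p b i) (adj_EI' ..) (adj_II' ..)

lemma edist_side {p : ℕ} (x y : ThetaVert p (fun _ => 3))
    (h : side p x = side p y) : (thetaGraph p (fun _ => 3)).edist x y ≤ 2 := by
  rcases cases_vert x with ⟨b, rfl⟩ | ⟨b, i, rfl⟩ <;>
  rcases cases_vert y with ⟨c, rfl⟩ | ⟨c, j, rfl⟩ <;> simp at h <;> subst h
  · simp
  · exact edist_EI ..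
  · rw [SimpleGraph.edist_comm]; exact edist_EI ..
  · exact d2 (E p b) (adj_EI' ..).symm (adj_EI' ..)

lemma edist_le {p : ℕ} (hp : 3 ≤ p) (x y : ThetaVert p (fun _ => 3)) :
    (thetaGraph p (fun _ => 3)).edist x y ≤ 3 := by
  by_cases h : side p x = side p y
  · exact (edist_side x y h).trans two_le_three'
  rcases cases_vert x with ⟨b, rfl⟩ | ⟨b, i, rfl⟩ <;>
  rcases cases_vert y with ⟨c, rfl⟩ | ⟨c, j, rfl⟩ <;> simp at h <;>
  obtain rfl : c = !b := by cases b <;> cases c <;> simp_all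
  · exact d3 (I p b ⟨0, by omega⟩) (I p (!b) ⟨0, by omega⟩) (adj_EI' ..) (adj_II' ..)
      (adj_EI' ..).symm
  · exact (edist_EI ..).trans two_le_three'
  · rw [SimpleGraph.edist_comm]; exact (edist_EI ..).trans two_le_three'
  · exact d3 (E p b) (I p b j) (adj_EI' ..).symm (adj_EI' ..) (adj_II' ..)

instance (p : ℕ) : Fintype (ThetaVert p (fun _ => 3)) :=
  inferInstanceAs (Fintype (Bool ⊕ (Σ _ : Fin p, Fin 2)))
instance (p : ℕ) : DecidableEq (ThetaVert p (fun _ => 3)) :=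
  inferInstanceAs (DecidableEq (Bool ⊕ (Σ _ : Fin p, Fin 2)))

lemma card_vert (p : ℕ) : Fintype.card (ThetaVert p (fun _ => 3)) = 2 + p * 2 := by
  change Fintype.card (Bool ⊕ (Σ _ : Fin p, Fin 2)) = _
  simp

/-- The upper-bound coloring. -/
def col (p : ℕ) (x : ThetaVert p (fun _ => 3)) : ℕ :=
  match idx p x, side p x with
  | none, false => 1
  | none, true => 2
  | some _, true => 1
  | some i, false => (i : ℕ) + 3

lemma upper (p : ℕ) : IsPackingColoring (thetaGraph p (fun _ => 3)) (p + 2) (col p) := by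
  constructor
  · intro x
    rcases cases_vert x with ⟨b, rfl⟩ | ⟨b, i, rfl⟩ <;> cases b <;> simp [col]
  · intro x y hxy hc
    have key : col p x = 1 ∧ ¬ (thetaGraph p (fun _ => 3)).Adj x y := by
      rcases cases_vert x with ⟨b, rfl⟩ | ⟨b, i, rfl⟩ <;>
      rcases cases_vert y with ⟨c, rfl⟩ | ⟨c, j, rfl⟩ <;> cases b <;> cases c <;>
      simp [col, Fin.ext_iff, adj_EE, adj_EI, adj_II, SimpleGraph.adj_comm _ (I _ _ _) (E _ _)]
        at hxy hc ⊢ <;> omega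
    rw [key.1]
    by_contra hlt
    have hle : (thetaGraph p (fun _ => 3)).edist x y ≤ 1 := by simpa using hlt
    rcases eq_or_lt_of_le hle with h | h
    · exact key.2 (SimpleGraph.edist_eq_one_iff_adj.1 h)
    · exact hxy (SimpleGraph.edist_eq_zero_iff.1 (Order.lt_one_iff.1 h))

lemma lower {p k : ℕ} (hp : 3 ≤ p) (π : ThetaVert p (fun _ => 3) → ℕ)
    (hπ : IsPackingColoring (thetaGraph p (fun _ => 3)) k π) : p + 2 ≤ k := by
  obtain ⟨hr, hd⟩ := hπ
  have hadj : ∀ x y, (thetaGraph p (fun _ => 3)).Adj x y → π x ≠ π y := by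
    intro x y h he
    have h1 := (hd x y h.ne he).trans_le (d1 h)
    have h2 : π x < 1 := by exact_mod_cast h1
    have := (hr x).1
    omega
  have htwo : ∀ x y, x ≠ y → π x = π y → (thetaGraph p (fun _ => 3)).edist x y ≤ 2 →
      π x < 2 := by
    intro x y h he hl
    have h1 := (hd x y h he).trans_le hl
    exact_mod_cast h1
  have hthree : ∀ x y, x ≠ y → π x = π y → π x < 3 := by
    intro x y h he
    have h1 := (hd x y h he).trans_le (edist_le hp x y)
    exact_mod_cast h1
  set A := Finset.univ.filter (fun x => π x = 1) with hA
  set B := Finset.univ.filter (fun x => π x = 2) with hB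
  set C := Finset.univ.filter (fun x => 3 ≤ π x) with hC
  have hcover : 2 + p * 2 ≤ A.card + B.card + C.card := by
    rw [← card_vert p, ← Finset.card_univ]
    have : (Finset.univ : Finset (ThetaVert p (fun _ => 3))) ⊆ A ∪ B ∪ C := by
      intro x _
      have := (hr x).1
      simp [A, B, C]; omega
    exact (Finset.card_le_card this).trans ((Finset.card_union_le _ _).trans
      (Nat.add_le_add_right (Finset.card_union_le _ _) _))
  have hCk : C.card ≤ k + 1 - 3 := by
    rw [← Nat.card_Icc]
    apply Finset.card_le_card_of_injOn π
    · intro x hx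
      simp [C] at hx
      simp [hx, (hr x).2]
    · intro x hx y hy he
      by_contra hne
      have := hthree x y hne he
      simp [C] at hx
      omega
  have hBinj : Set.InjOn (side p) B := by
    intro x hx y hy he
    by_contra hne
    simp [B] at hx hy
    have := htwo x y hne (hx.trans hy.symm) (edist_side x y he)
    omega
  have hB2 : B.card ≤ 2 := by
    simpa using Finset.card_le_card_of_injOn (t := (Finset.univ : Finset Bool)) (side p)
      (fun _ _ => Finset.mem_coe.2 (Finset.mem_univ _)) hBinj
  have hEI : ∀ b i, π (E p b) = 1 → π (I p b i) ≠ 1 := fun b i h h' =>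
    hadj _ _ (adj_EI' p b i) (h.trans h'.symm)
  have hII : ∀ b i, π (I p b i) = 1 → π (I p (!b) i) ≠ 1 := fun b i h h' =>
    hadj _ _ (adj_II' p b i) (h.trans h'.symm)
  have main : A.card + B.card ≤ p + 2 := by
    by_cases huv : π (E p false) = 1 ∧ π (E p true) = 1
    · have : A ⊆ {E p false, E p true} := by
        intro x hx
        simp [A] at hx
        rcases cases_vert x with ⟨b, rfl⟩ | ⟨b, i, rfl⟩
        · cases b <;> simp
        · cases b
          · exact absurd hx (hEI _ _ huv.1)
          · exact absurd hx (hEI _ _ huv.2)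
      have := (Finset.card_le_card this).trans Finset.card_le_two
      omega
    have hAinj : Set.InjOn (idx p) A := by
      intro x hx y hy he
      simp [A] at hx hy
      rcases cases_vert x with ⟨b, rfl⟩ | ⟨b, i, rfl⟩ <;>
      rcases cases_vert y with ⟨c, rfl⟩ | ⟨c, j, rfl⟩ <;> simp at he
      · cases b <;> cases c <;> simp_all
      · subst he
        have := hII b i hx
        cases b <;> cases c <;> simp_all
    by_cases hB1 : B.card ≤ 1
    · have : A.card ≤ p + 1 := by
        simpa using Finset.card_le_card_of_injOn (t := (Finset.univ : Finset (Option (Fin p))))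
          (idx p) (by simp) hAinj
      omega
    have miss : ∀ o, (∀ x, π x = 1 → idx p x ≠ o) → A.card ≤ p := by
      intro o ho
      have := Finset.card_le_card_of_injOn
        (t := (Finset.univ : Finset (Option (Fin p))).erase o)
          (idx p) (fun x hx => by simp [A] at hx; simpa using ho x hx) hAinj
      simpa [Finset.card_erase_of_mem] using this
    have hsurj : ∀ b, ∃ x, π x = 2 ∧ side p x = b := by
      intro b
      by_contra hcon
      push Not at hcon
      apply hB1
      rw [Finset.card_le_one]
      intro x hx y hy
      apply hBinj hx hy
      simp [B] at hx hy
      have h1 := hcon x hx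
      have h2 := hcon y hy
      generalize side p x = s at *
      generalize side p y = t at *
      cases b <;> cases s <;> cases t <;> simp_all
    suffices A.card ≤ p by omega
    have missnone : π (E p false) ≠ 1 → π (E p true) ≠ 1 → A.card ≤ p := by
      intro h1 h2
      apply miss none
      intro x hx
      rcases cases_vert x with ⟨b, rfl⟩ | ⟨b, i, rfl⟩
      · cases b <;> contradiction
      · simp
    obtain ⟨x, hx, hxs⟩ := hsurj false
    obtain ⟨y, hy, hys⟩ := hsurj true
    rcases cases_vert x with ⟨b, rfl⟩ | ⟨b, i, rfl⟩ <;>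
      rcases cases_vert y with ⟨c, rfl⟩ | ⟨c, j, rfl⟩ <;> simp at hxs hys <;> subst hxs <;>
      subst hys
    · apply missnone <;> omega
    · have := htwo _ _ (by simp) (hx.trans hy.symm) (edist_EI ..)
      omega
    · have := htwo _ _ (by simp) (hy.trans hx.symm) (edist_EI ..)
      omega
    · have hm : ∀ c i, π (E p (!c)) = 1 → π (I p c i) = 2 → A.card ≤ p := by
        intro c i hE h2
        apply miss (some i)
        intro x hx he
        rcases cases_vert x with ⟨b, rfl⟩ | ⟨b, j, rfl⟩
        · simp at he
        · simp at he
          subst he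
          rcases eq_or_ne b c with rfl | hbc
          · omega
          · obtain rfl : b = !c := by cases b <;> cases c <;> simp_all
            exact hEI _ _ hE hx
      by_cases hu : π (E p false) = 1
      · exact hm true j hu hy
      by_cases hv : π (E p true) = 1
      · exact hm false i hv hx
      exact missnone hu hv
  omega

end ThetaThree

theorem stmt1 (p : ℕ) (ℓ : Fin p → ℕ) (hp : 3 ≤ p) (h3 : ∀ i, ℓ i = 3) :
    packingChromaticNumber (thetaGraph p ℓ) = p + 2 := by
  obtain rfl : ℓ = fun _ => 3 := funext h3
  apply le_antisymm
  · exact Nat.sInf_le ⟨_, ThetaThree.upper p⟩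
  · refine le_csInf ⟨p + 2, ThetaThree.col p, ThetaThree.upper p⟩ ?_
    rintro k ⟨π, hπ⟩
    exact ThetaThree.lower hp π hπ
end

section
/- Let Θ = Θ_{ℓ1,…,ℓp} be a generalized theta graph with p ≥ 3, and let k > 5 be an integer. Then χρ(Θ) = k if and only if n_3 = k − 2, where n_3 is the number of indices i with ℓ_i = 3. -/
/-- Colour of the vertex at position `a` of a path of length `L` (rank `r` among 3-paths). -/
def tcol (L r a : ℕ) : ℕ :=
  if L = 3 then
    (if a = 1 then (if r = 0 then 2 else if r = 1 then 1 else if r = 2 then 3 else r + 3)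
      else if r = 1 then 2 else 1)
  else if L % 2 = 0 then
    (if a % 2 = 1 then 1 else if a % 4 = 2 then 2 else 3)
  else if a = 1 then 1 else if a = 2 then 2 else
    (if a % 2 = 0 then 1 else if a % 4 = 3 then 3 else 2)

lemma tcol_pos (L r a : ℕ) : 1 ≤ tcol L r a := by
  unfold tcol; split_ifs <;> omega

lemma tcol_le (L r a m : ℕ) (h : L = 3 → r < m) : tcol L r a ≤ max 5 (m + 2) := by
  unfold tcol; split_ifs <;> omega

lemma tcol_ne (L r a c : ℕ) (hc : c = 4 ∨ c = 5) : tcol L r a ≠ c := by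
  unfold tcol; split_ifs <;> omega

lemma tcol_two (L r a : ℕ) (h1 : 1 ≤ a) (h2 : a < L) (h : tcol L r a = 2) :
    (L = 3 ∧ r = 0 ∧ a = 1) ∨ (L = 3 ∧ r = 1 ∧ a = 2) ∨ (2 ≤ a ∧ a + 2 ≤ L) := by
  unfold tcol at h; split_ifs at h <;> omega

lemma tcol_three (L r a : ℕ) (h1 : 1 ≤ a) (h2 : a < L) (h : tcol L r a = 3) :
    (L = 3 ∧ r = 2 ∧ a = 1) ∨ (3 ≤ a ∧ a + 2 ≤ L) := by
  unfold tcol at h; split_ifs at h <;> omega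

lemma tcol_big (L r a : ℕ) (h : 4 ≤ tcol L r a) :
    L = 3 ∧ a = 1 ∧ tcol L r a = r + 3 := by
  unfold tcol at h ⊢; split_ifs at h ⊢ <;> omega

lemma tcol_same (L r a b : ℕ) (h1 : 1 ≤ a) (hab : a < b) (h2 : b < L)
    (h : tcol L r a = tcol L r b) : tcol L r a + a < b := by
  unfold tcol at h ⊢; split_ifs at h ⊢ <;> omega

/-- Lower bound for the distance from the vertex at position `a` on path `i`. -/
def tdist (p : ℕ) (ℓ : Fin p → ℕ) (i : Fin p) (a : ℕ) : ThetaVert p ℓ → ℕ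
  | Sum.inl false => min a (ℓ i - a + 1)
  | Sum.inl true => min (ℓ i - a) (a + 1)
  | Sum.inr ⟨i', j⟩ =>
      if i' = i then min ((a - (j + 1)) + ((j + 1) - a))
        (min (min a (ℓ i - a + 1) + (j + 1)) (min (ℓ i - a) (a + 1) + (ℓ i - (j + 1))))
      else min (min a (ℓ i - a + 1) + (j + 1)) (min (ℓ i - a) (a + 1) + (ℓ i' - (j + 1)))

lemma tmin_step (x x' y y' z z' : ℕ) (h1 : x ≤ x' + 1) (h1' : x' ≤ x + 1)
    (h2 : y ≤ y' + 1) (h2' : y' ≤ y + 1) (h3 : z ≤ z' + 1) (h3' : z' ≤ z + 1) :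
    min x' (min y' z') ≤ min x (min y z) + 1 ∧ min x (min y z) ≤ min x' (min y' z') + 1 := by
  omega

lemma tdist_rel (p : ℕ) (ℓ : Fin p → ℕ) (i : Fin p) (a : ℕ) (ha : 1 ≤ a) (ha2 : a < ℓ i)
    (x y : ThetaVert p ℓ) (h : thetaRel p ℓ x y) :
    tdist p ℓ i a y ≤ tdist p ℓ i a x + 1 ∧ tdist p ℓ i a x ≤ tdist p ℓ i a y + 1 := by
  rcases x with (_ | _) | ⟨i1, j1⟩ <;> rcases y with (_ | _) | ⟨i2, j2⟩ <;>
    simp only [thetaRel, tdist] at h ⊢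
  · simp at h
  · omega
  · have := j2.2
    simp at h
    obtain ⟨A, hA⟩ : ∃ A, min a (ℓ i - a + 1) = A := ⟨_, rfl⟩
    obtain ⟨B, hB⟩ : ∃ B, min (ℓ i - a) (a + 1) = B := ⟨_, rfl⟩
    rw [hA, hB]
    have hAB : A ≤ B + 1 ∧ B ≤ A + 1 := by omega
    have hA1 : A ≤ a ∧ (A = a ∨ A = B + 1) := by omega
    have hB1 : B ≤ ℓ i - a ∧ (B = ℓ i - a ∨ B = A + 1) := by omega
    clear hA hB
    split_ifs with hi
    · subst hi; omega
    · omega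
  · simp at h
  · simp at h
  · have := j2.2
    simp at h
    obtain ⟨A, hA⟩ : ∃ A, min a (ℓ i - a + 1) = A := ⟨_, rfl⟩
    obtain ⟨B, hB⟩ : ∃ B, min (ℓ i - a) (a + 1) = B := ⟨_, rfl⟩
    rw [hA, hB]
    have hAB : A ≤ B + 1 ∧ B ≤ A + 1 := by omega
    have hA1 : A ≤ a ∧ (A = a ∨ A = B + 1) := by omega
    have hB1 : B ≤ ℓ i - a ∧ (B = ℓ i - a ∨ B = A + 1) := by omega
    clear hA hB
    split_ifs with hi
    · subst hi; omega
    · omega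
  · obtain ⟨h1, h2⟩ := h
    have h1 : i1 = i2 := Fin.ext h1
    subst h1
    have e1 := j1.2
    have e2 := j2.2
    generalize min a (ℓ i - a + 1) = A
    generalize min (ℓ i - a) (a + 1) = B
    split_ifs with hi
    · subst hi
      have k1 := tmin_step (a - (j1 + 1) + (j1 + 1 - a)) (a - (j2 + 1) + (j2 + 1 - a))
        (A + (j1 + 1)) (A + (j2 + 1)) (B + (ℓ i1 - (j1 + 1))) (B + (ℓ i1 - (j2 + 1)))
      apply k1 <;> omega
    · omega

lemma tdist_adj (p : ℕ) (ℓ : Fin p → ℕ) (i : Fin p) (a : ℕ) (ha : 1 ≤ a) (ha2 : a < ℓ i)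
    (x y : ThetaVert p ℓ) (h : (thetaGraph p ℓ).Adj x y) :
    tdist p ℓ i a y ≤ tdist p ℓ i a x + 1 := by
  rw [thetaGraph, SimpleGraph.fromRel_adj] at h
  rcases h.2 with h | h
  · exact (tdist_rel p ℓ i a ha ha2 _ _ h).1
  · exact (tdist_rel p ℓ i a ha ha2 _ _ h).2

lemma tdist_walk (p : ℕ) (ℓ : Fin p → ℕ) (i : Fin p) (a : ℕ) (ha : 1 ≤ a) (ha2 : a < ℓ i)
    (x y : ThetaVert p ℓ) (w : (thetaGraph p ℓ).Walk x y) :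
    tdist p ℓ i a y ≤ tdist p ℓ i a x + w.length := by
  induction w with
  | nil => simp
  | cons h w ih =>
    have := tdist_adj p ℓ i a ha ha2 _ _ h
    simp only [SimpleGraph.Walk.length_cons]
    omega

lemma tdist_edist (p : ℕ) (ℓ : Fin p → ℕ) (i : Fin p) (j : Fin (ℓ i - 1))
    (y : ThetaVert p ℓ) :
    ((tdist p ℓ i (j + 1) y : ℕ) : ℕ∞) ≤ (thetaGraph p ℓ).edist (Sum.inr ⟨i, j⟩) y := by
  unfold SimpleGraph.edist
  refine le_iInf fun w => ?_
  have := tdist_walk p ℓ i (j + 1) (by omega) (by omega) _ _ w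
  have h0 : tdist p ℓ i (j + 1) (Sum.inr ⟨i, j⟩) = 0 := by simp [tdist]
  rw [h0, zero_add] at this
  exact_mod_cast this

/-- The colouring. -/
def thetaCol (p : ℕ) (ℓ : Fin p → ℕ) (r : Fin p → ℕ) : ThetaVert p ℓ → ℕ
  | Sum.inl false => 4
  | Sum.inl true => 5
  | Sum.inr ⟨i, j⟩ => tcol (ℓ i) (r i) (j + 1)

lemma exists_rank (p : ℕ) (ℓ : Fin p → ℕ) : ∃ r : Fin p → ℕ,
    (∀ i, ℓ i = 3 → r i < pathCount p ℓ 3) ∧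
    (∀ i j, ℓ i = 3 → ℓ j = 3 → r i = r j → i = j) := by
  classical
  let S := Finset.univ.filter (fun i : Fin p => ℓ i = 3)
  have hS : ∀ i, ℓ i = 3 → i ∈ S := fun i hi => by simp [S, hi]
  refine ⟨fun i => if h : i ∈ S then (S.equivFin ⟨i, h⟩ : ℕ) else 0, ?_, ?_⟩
  · intro i hi
    simp only [hS i hi, dif_pos]
    exact (S.equivFin ⟨i, hS i hi⟩).2
  · intro i j hi hj h
    simp only [hS i hi, hS j hj, dif_pos] at h
    have := S.equivFin.injective (Fin.ext h)
    simpa using this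

lemma theta_upper (p : ℕ) (ℓ : Fin p → ℕ) :
    ∃ π, IsPackingColoring (thetaGraph p ℓ) (max 5 (pathCount p ℓ 3 + 2)) π := by
  obtain ⟨r, hr, hinj⟩ := exists_rank p ℓ
  refine ⟨thetaCol p ℓ r, ?_, ?_⟩
  · rintro ((_ | _) | ⟨i, j⟩)
    · change 1 ≤ 4 ∧ 4 ≤ _
      omega
    · change 1 ≤ 5 ∧ 5 ≤ _
      omega
    · exact ⟨tcol_pos _ _ _, tcol_le _ _ _ _ (hr i)⟩
  · rintro ((_ | _) | ⟨i, j⟩) ((_ | _) | ⟨i', j'⟩) hne h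
    · exact absurd rfl hne
    · change 4 = 5 at h
      omega
    · exact absurd h.symm (tcol_ne _ _ _ 4 (by simp))
    · change 5 = 4 at h
      omega
    · exact absurd rfl hne
    · exact absurd h.symm (tcol_ne _ _ _ 5 (by simp))
    · exact absurd h (tcol_ne _ _ _ 4 (by simp))
    · exact absurd h (tcol_ne _ _ _ 5 (by simp))
    · refine lt_of_lt_of_le ?_ (tdist_edist p ℓ i j _)
      simp only [thetaCol] at h ⊢
      norm_cast
      have hj := j.2
      have hj' := j'.2
      simp only [tdist]
      have P := tcol_pos (ℓ i) (r i) (j + 1)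
      have A2 := tcol_two (ℓ i) (r i) (j + 1) (by omega) (by omega)
      have A3 := tcol_three (ℓ i) (r i) (j + 1) (by omega) (by omega)
      have A4 := tcol_big (ℓ i) (r i) (j + 1)
      have B2 := tcol_two (ℓ i') (r i') (j' + 1) (by omega) (by omega)
      have B3 := tcol_three (ℓ i') (r i') (j' + 1) (by omega) (by omega)
      have B4 := tcol_big (ℓ i') (r i') (j' + 1)
      split_ifs with hi
      · subst hi
        have hjj : (j : ℕ) ≠ j' := by
          intro hh
          exact hne (by rw [Fin.ext hh])
        rcases lt_or_gt_of_ne hjj with hlt | hlt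
        · have := tcol_same (ℓ i') (r i') (j + 1) (j' + 1) (by omega) (by omega) (by omega) h
          omega
        · have := tcol_same (ℓ i') (r i') (j' + 1) (j + 1) (by omega) (by omega) (by omega) h.symm
          omega
      · have hI := hinj i i'
        have hI : ℓ i = 3 → ℓ i' = 3 → r i ≠ r i' := fun a b c => hi (hI a b c).symm
        clear hinj hr hne hi
        generalize tcol (ℓ i) (r i) (j + 1) = c at *
        generalize tcol (ℓ i') (r i') (j' + 1) = c' at *
        subst h
        have : c = 1 ∨ c = 2 ∨ c = 3 ∨ 4 ≤ c := by omega
        rcases this with rfl | rfl | rfl | h4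
        · omega
        · have := A2 rfl
          have := B2 rfl
          clear A2 A3 A4 B2 B3 B4
          omega
        · have := A3 rfl
          have := B3 rfl
          clear A2 A3 A4 B2 B3 B4
          omega
        · have := A4 h4
          have := B4 h4
          omega

lemma comb_lower {ι : Type*} [Fintype ι] [DecidableEq ι] (k : ℕ) (hm : 2 ≤ Fintype.card ι)
    (c : Bool × Option ι → ℕ) (hc : ∀ a, 1 ≤ c a ∧ c a ≤ k)
    (h2 : ∀ b s t, s ≠ t → c (b, s) = c (b, t) → c (b, s) < 2)
    (h4 : ∀ b i, c (!b, none) = c (b, some i) → c (b, some i) < 2)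
    (h3 : ∀ s t, s ≠ t → c s = c t → c s < 3)
    (h1 : ∀ b i, c (b, none) = 1 → c (b, some i) ≠ 1)
    (h1' : ∀ i, c (false, some i) = 1 → c (true, some i) ≠ 1) :
    Fintype.card ι + 2 ≤ k := by
  have LA : ∀ S : Finset (Bool × Option ι), (∀ a ∈ S, 2 ≤ c a) → 2 ≤ k → S.card ≤ k := by
    intro S hS hk
    let g : Bool × Option ι → ℕ := fun a => if c a = 2 then (if a.1 then 1 else 2) else c a
    have := Finset.card_le_card_of_injOn (s := S) (t := Finset.Icc 1 k) g
      (by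
        intro a ha
        have := hc a
        simp only [g, Finset.coe_Icc, Set.mem_Icc]
        split_ifs <;> omega)
      (by
        rintro ⟨b, s⟩ ha ⟨b', t⟩ hb hab
        have e1 := hS _ ha
        have e2 := hS _ hb
        by_contra hne
        have e3 := h3 _ _ hne
        by_cases hbb : b = b'
        · subst hbb
          have e4 := h2 b s t (by rintro rfl; exact hne rfl)
          simp only [g] at hab
          split_ifs at hab <;> omega
        · simp only [g] at hab
          rcases b with _ | _ <;> rcases b' with _ | _ <;> simp at hbb hab <;>
            split_ifs at hab <;> omega)
    simpa using this
  have LB : ∀ b, (∀ i, c (b, some i) ≠ 1) → c (!b, none) ≠ 1 → Fintype.card ι + 2 ≤ k := by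
    intro b hb hb'
    let g : Option ι → ℕ := fun s => match s with
      | none => c (!b, none)
      | some i => c (b, some i)
    have hb2 : ∀ i, 2 ≤ c (b, some i) := by
      intro i
      have := (hc (b, some i)).1
      have := hb i
      omega
    have := Finset.card_le_card_of_injOn (s := (Finset.univ : Finset (Option ι)))
      (t := Finset.Icc 2 k) g
      (by
        rintro (_ | i) _ <;> simp only [Finset.coe_Icc, Set.mem_Icc, g]
        · have := hc (!b, none)
          omega
        · exact ⟨hb2 i, (hc _).2⟩)
      (by
        rintro (_ | i) _ (_ | j) _ hst <;> simp only [g] at hst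
        · rfl
        · have := h4 b j hst
          have := hb2 j
          omega
        · have := h4 b i hst.symm
          have := hb2 i
          omega
        · by_contra hne
          have := h2 b _ _ hne hst
          have := hb2 i
          omega)
    simp at this
    omega
  have hk2 : 2 ≤ k := by
    obtain ⟨i⟩ : Nonempty ι := Fintype.card_pos_iff.mp (by omega)
    have e1 := h1' i
    have e2 := hc (false, some i)
    have e3 := hc (true, some i)
    omega
  by_cases hu : c (false, none) = 1
  · by_cases hv : c (true, none) = 1
    · have := LA ((Finset.univ : Finset (Bool × ι)).image (fun q => (q.1, some q.2))) (by
        intro a ha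
        simp only [Finset.mem_image, Finset.mem_univ, true_and] at ha
        obtain ⟨⟨b, i⟩, rfl⟩ := ha
        have e1 := (hc (b, some i)).1
        have e2 : c (b, some i) ≠ 1 := h1 b i (by cases b <;> assumption)
        simp only
        omega) hk2
      rw [Finset.card_image_of_injective _ (by
        rintro ⟨b, i⟩ ⟨b', i'⟩ h
        simpa using h)] at this
      simp at this
      omega
    · exact LB false (fun i => h1 false i hu) hv
  · by_cases hv : c (true, none) = 1
    · exact LB true (fun i => h1 true i hv) hu
    · let z : Option ι ⊕ Unit → Bool × Option ι := fun q => match q with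
        | Sum.inl none => (false, none)
        | Sum.inl (some i) => (if c (false, some i) = 1 then true else false, some i)
        | Sum.inr _ => (true, none)
      have hz : Function.Injective z := by
        rintro ((_ | i) | _) ((_ | i') | _) h <;> simp [z] at h ⊢
        exact h.2
      have := LA (Finset.univ.image z) (by
        intro a ha
        simp only [Finset.mem_image, Finset.mem_univ, true_and] at ha
        obtain ⟨((_ | i) | _), rfl⟩ := ha
        · have := hc (false, none); simp only [z]; omega
        · have e1 := hc (false, some i)
          have e2 := hc (true, some i)
          have e3 := h1' i
          simp only [z]
          split_ifs with h
          · have := e3 h; omega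
          · omega
        · have := hc (true, none); simp only [z]; omega) hk2
      rw [Finset.card_image_of_injective _ hz] at this
      simp at this
      omega

lemma theta_lower (p : ℕ) (ℓ : Fin p → ℕ) (hm : 2 ≤ pathCount p ℓ 3) (k : ℕ)
    (π : ThetaVert p ℓ → ℕ) (hπ : IsPackingColoring (thetaGraph p ℓ) k π) :
    pathCount p ℓ 3 + 2 ≤ k := by
  classical
  obtain ⟨hc, hd⟩ := hπ
  let ι := {i : Fin p // ℓ i = 3}
  have hcard : Fintype.card ι = pathCount p ℓ 3 := by
    simp only [ι, pathCount]
    exact Fintype.card_subtype _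
  let f : Bool × Option ι → ThetaVert p ℓ := fun q => match q with
    | (b, none) => Sum.inl b
    | (false, some i) => Sum.inr ⟨i.1, ⟨0, by have := i.2; omega⟩⟩
    | (true, some i) => Sum.inr ⟨i.1, ⟨1, by have := i.2; omega⟩⟩
  have hf : Function.Injective f := by
    rintro ⟨_ | _, _ | ⟨i, hi⟩⟩ ⟨_ | _, _ | ⟨j, hj⟩⟩ h
    all_goals first
      | rfl
      | (exfalso; injection h; done)
      | (exfalso; injection h with h; injection h; done)
      | (injection h with h
         injection h with h1 h2
         subst h1
         first
          | rfl
          | (exfalso; simp at h2))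
  have hfn : ∀ s t, s ≠ t → f s ≠ f t := fun s t h h' => h (hf h')
  set G := thetaGraph p ℓ with hG
  have a1 : ∀ b i, G.edist (f (b, none)) (f (b, some i)) ≤ 1 := by
    intro b i
    have : G.Adj (f (b, none)) (f (b, some i)) := by
      rw [hG, thetaGraph, SimpleGraph.fromRel_adj]
      refine ⟨fun h => hfn (b, none) (b, some i) (by simp) h, Or.inl ?_⟩
      have := i.2
      cases b <;> simp [f, thetaRel, this]
    exact (SimpleGraph.edist_eq_one_iff_adj.mpr this).le
  have a2 : ∀ i, G.edist (f (false, some i)) (f (true, some i)) ≤ 1 := by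
    intro i
    have : G.Adj (f (false, some i)) (f (true, some i)) := by
      rw [hG, thetaGraph, SimpleGraph.fromRel_adj]
      refine ⟨fun h => hfn (false, some i) (true, some i) (by simp) h, Or.inl ?_⟩
      simp [f, thetaRel]
    exact (SimpleGraph.edist_eq_one_iff_adj.mpr this).le
  have a1' : ∀ b i, G.edist (f (b, some i)) (f (b, none)) ≤ 1 := fun b i => by
    rw [SimpleGraph.edist_comm]; exact a1 b i
  have a2' : ∀ b i, G.edist (f (b, some i)) (f (!b, some i)) ≤ 1 := fun b i => by
    cases b
    · exact a2 i
    · rw [SimpleGraph.edist_comm]; exact a2 i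
  have tri : ∀ (x y z : ThetaVert p ℓ) (m n : ℕ), G.edist x y ≤ m → G.edist y z ≤ n →
      G.edist x z ≤ ((m + n : ℕ) : ℕ∞) := by
    intro x y z m n h1 h2
    push_cast
    exact SimpleGraph.edist_triangle.trans (add_le_add h1 h2)
  have d2 : ∀ b s t, G.edist (f (b, s)) (f (b, t)) ≤ (2 : ℕ) := by
    intro b s t
    have one2 : (1 : ℕ∞) ≤ (2 : ℕ) := by norm_num
    rcases s with _ | i <;> rcases t with _ | j
    · simp
    · exact (a1 b j).trans one2
    · exact (a1' b i).trans one2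
    · exact tri _ _ _ 1 1 (a1' b i) (a1 b j)
  have d4 : ∀ b i, G.edist (f (!b, none)) (f (b, some i)) ≤ (2 : ℕ) := by
    intro b i
    refine tri _ _ _ 1 1 (a1 (!b) i) ?_
    have := a2' (!b) i
    simpa using this
  have d3' : ∀ b s t, G.edist (f (b, s)) (f (!b, t)) ≤ (3 : ℕ) := by
    intro b s t
    rcases t with _ | j
    · obtain ⟨i⟩ : Nonempty ι := Fintype.card_pos_iff.mp (by omega)
      rcases s with _ | i'
      · refine tri _ _ _ 1 2 (a1 b i) ?_
        rw [SimpleGraph.edist_comm]; exact d4 b i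
      · rw [SimpleGraph.edist_comm]
        exact (d4 b i').trans (by norm_num)
    · exact tri _ _ _ 2 1 (d2 b s (some j)) (a2' b j)
  have d3 : ∀ s t, G.edist (f s) (f t) ≤ (3 : ℕ) := by
    rintro ⟨b, s⟩ ⟨b', t⟩
    by_cases h : b' = b
    · subst h
      exact (d2 _ _ _).trans (by norm_num)
    · have : b' = !b := by cases b <;> cases b' <;> simp_all
      subst this
      exact d3' _ _ _
  have key : ∀ (s t : Bool × Option ι) (n : ℕ), s ≠ t → G.edist (f s) (f t) ≤ n →
      π (f s) = π (f t) → π (f s) < n := by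
    intro s t n hst hle he
    have := (hd _ _ (fun h => hst (hf h)) he).trans_le hle
    exact_mod_cast this
  rw [← hcard] at hm ⊢
  refine comb_lower k hm (fun q => π (f q)) (fun a => hc _) ?_ ?_ ?_ ?_ ?_
  · intro b s t hst h
    exact key _ _ 2 (by simpa using hst) (d2 b s t) h
  · intro b i h
    have := key (!b, none) (b, some i) 2 (by simp) (d4 b i) h
    change π (f (!b, none)) = π (f (b, some i)) at h
    change π (f (b, some i)) < 2
    omega
  · intro s t hst h
    exact key _ _ 3 hst (d3 s t) h
  · intro b i h h'
    have := key (b, none) (b, some i) 1 (by simp) (by simpa using a1 b i) (h.trans h'.symm)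
    change π _ = 1 at h
    omega
  · intro i h h'
    have := key (false, some i) (true, some i) 1 (by simp) (by simpa using a2 i) (h.trans h'.symm)
    change π _ = 1 at h
    omega

theorem stmt2 (p : ℕ) (ℓ : Fin p → ℕ) (hp : 3 ≤ p)
    (hmono : Monotone ℓ) (hpos : ∀ i, 1 ≤ ℓ i) (hsimple : 2 ≤ ℓ ⟨1, by omega⟩) (k : ℕ) (hk : 5 < k) :
    packingChromaticNumber (thetaGraph p ℓ) = k ↔ pathCount p ℓ 3 = k - 2 := by
  have hup : packingChromaticNumber (thetaGraph p ℓ) ≤ max 5 (pathCount p ℓ 3 + 2) :=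
    Nat.sInf_le (theta_upper p ℓ)
  have hlow : 2 ≤ pathCount p ℓ 3 →
      pathCount p ℓ 3 + 2 ≤ packingChromaticNumber (thetaGraph p ℓ) := by
    intro hm
    obtain ⟨π, hπ⟩ := Nat.sInf_mem (s := {k | ∃ π, IsPackingColoring (thetaGraph p ℓ) k π})
      ⟨_, theta_upper p ℓ⟩
    exact theta_lower p ℓ hm _ π hπ
  omega
end

section
/- Let Θ = Θ_{ℓ1,…,ℓp} be a generalized theta graph with p ≥ 2. Then χρ(Θ) = 3 if and only if one of the following conditions holds: (i) ℓ1 = 1 and ℓ2 = … = ℓp = 2; or (ii) for every i and j with 1 ≤ i < j ≤ p, ℓ_i + ℓ_j ≡ 0 (mod 4). -/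
lemma seq_no23 (c : ℕ → ℕ) (h0 : ∀ t, 1 ≤ c t ∧ c t ≤ 3) (h1 : ∀ t, c t ≠ c (t + 1))
    (h2 : ∀ t, c t = c (t + 2) → c t = 1) (h3 : ∀ t, c t = c (t + 3) → c t ≠ 3) (t : ℕ) :
    c (t + 2) = 1 ∨ c (t + 3) = 1 := by
  have a0 := h0 t; have a1 := h0 (t+1); have a2 := h0 (t+2); have a3 := h0 (t+3)
  have a4 := h0 (t+4); have a5 := h0 (t+5)
  have b0 := h1 t; have b1 := h1 (t+1); have b2 := h1 (t+2); have b3 := h1 (t+3)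
  have b4 := h1 (t+4)
  have c0 := h2 t; have c1 := h2 (t+1); have c2 := h2 (t+2); have c3 := h2 (t+3)
  have d0 := h3 t; have d1 := h3 (t+1); have d2 := h3 (t+2)
  simp only [Nat.add_assoc, Nat.reduceAdd] at *
  omega

lemma seq_dvd (c : ℕ → ℕ) (n : ℕ) (h0 : ∀ t, 1 ≤ c t ∧ c t ≤ 3) (h1 : ∀ t, c t ≠ c (t + 1))
    (h2 : ∀ t, c t = c (t + 2) → c t = 1) (h3 : ∀ t, c t = c (t + 3) → c t ≠ 3)
    (hn : ∀ t, c (t + n) = c t) : n % 4 = 0 := by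
  have key := seq_no23 c h0 h1 h2 h3
  have step : ∀ t, c (t + 2) = 2 → c (t+3) = 1 ∧ c (t + 4) = 3 ∧ c (t+5) = 1 ∧ c (t+6) = 2 := by
    intro t ht
    have a3 := h0 (t+3); have a4 := h0 (t+4); have a5 := h0 (t+5); have a6 := h0 (t+6)
    have b2 := h1 (t+2); have b3 := h1 (t+3); have b4 := h1 (t+4); have b5 := h1 (t+5)
    have c2 := h2 (t+2); have c3 := h2 (t+3); have c4 := h2 (t+4)
    have k0 := key t; have k1 := key (t+1); have k2 := key (t+2); have k3 := key (t+3)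
    simp only [Nat.add_assoc, Nat.reduceAdd] at *
    omega
  obtain ⟨s, hs⟩ : ∃ s, c (s + 2) = 2 := by
    by_contra hne
    push Not at hne
    have e0 := hne 0; have e1 := hne 1; have e2 := hne 2; have e3 := hne 3
    have a0 := h0 2; have a1 := h0 3; have a2 := h0 4; have a3 := h0 5
    have b0 := h1 2; have b1 := h1 3; have b2 := h1 4
    have c0 := h2 2; have c1 := h2 3
    simp only [Nat.reduceAdd] at *
    omega
  have hk : ∀ k, c (s + 2 + 4 * k) = 2 := by
    intro k
    induction k with
    | zero => simpa using hs
    | succ k ih =>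
      have := step (s + 4 * k) (by rw [show s + 4 * k + 2 = s + 2 + 4 * k by omega]; exact ih)
      rw [show s + 2 + 4 * (k + 1) = s + 4 * k + 6 by omega]; exact this.2.2.2
  have hq := step (s + 4 * (n / 4)) (by rw [show s + 4 * (n / 4) + 2 = s + 2 + 4 * (n / 4) by omega]; exact hk _)
  have hnn := hn (s + 2)
  rw [hs] at hnn
  by_contra hne
  have : n % 4 = 1 ∨ n % 4 = 2 ∨ n % 4 = 3 := by omega
  rcases this with h | h | h
  · rw [show s + 2 + n = s + 4 * (n / 4) + 3 by omega] at hnn; omega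
  · rw [show s + 2 + n = s + 4 * (n / 4) + 4 by omega] at hnn; omega
  · rw [show s + 2 + n = s + 4 * (n / 4) + 5 by omega] at hnn; omega

section Walks
variable {V : Type*} {G : SimpleGraph V} {w : ℕ → V}

lemma edist_seq (hadj : ∀ t, G.Adj (w t) (w (t + 1))) (t k : ℕ) :
    G.edist (w t) (w (t + k)) ≤ k := by
  induction k with
  | zero => simp
  | succ k ih =>
    have h1 : G.edist (w (t + k)) (w (t + k + 1)) = 1 :=
      SimpleGraph.edist_eq_one_iff_adj.2 (hadj _)
    calc _ ≤ _ := SimpleGraph.edist_triangle (v := w (t + k))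
      _ ≤ _ := by rw [← Nat.add_assoc, h1]; push_cast; gcongr

lemma color_seq {m : ℕ} {π : V → ℕ} (hπ : IsPackingColoring G m π)
    (hadj : ∀ t, G.Adj (w t) (w (t + 1))) (t k : ℕ) (hne : w t ≠ w (t + k))
    (he : π (w t) = π (w (t + k))) : π (w t) < k := by
  have := (hπ.2 _ _ hne he).trans_le (edist_seq hadj t k)
  exact_mod_cast this

lemma no_two {m : ℕ} {π : V → ℕ} (hm : m ≤ 2) (hπ : IsPackingColoring G m π)
    (hadj : ∀ t, G.Adj (w t) (w (t + 1))) (h2 : ∀ t, w t ≠ w (t + 2)) : False := by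
  have e1 := fun t => color_seq hπ hadj t 1 (hadj t).ne
  have e2 := fun t => color_seq hπ hadj t 2 (h2 t)
  have a0 := hπ.1 (w 0); have a1 := hπ.1 (w 1); have a2 := hπ.1 (w 2); have a3 := hπ.1 (w 3)
  have b0 := e1 0; have b1 := e1 1; have b2 := e1 2
  have c0 := e2 0; have c1 := e2 1
  simp only [Nat.reduceAdd] at *
  omega

lemma three_dvd {π : V → ℕ} (n : ℕ) (hπ : IsPackingColoring G 3 π)
    (hadj : ∀ t, G.Adj (w t) (w (t + 1))) (h2 : ∀ t, w t ≠ w (t + 2))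
    (h3 : ∀ t, w t ≠ w (t + 3)) (hn : ∀ t, w (t + n) = w t) : n % 4 = 0 := by
  apply seq_dvd (fun t => π (w t)) n (fun t => hπ.1 _)
  · intro t h
    have := color_seq hπ hadj t 1 (hadj t).ne h
    have := (hπ.1 (w t)).1
    omega
  · intro t h
    have := color_seq hπ hadj t 2 (h2 t) h
    have := (hπ.1 (w t)).1
    show π (w t) = 1
    omega
  · intro t h
    have := color_seq hπ hadj t 3 (h3 t) h
    show π (w t) ≠ 3
    omega
  · intro t; show π _ = π _; rw [hn]

end Walks

/-- The `k`-th vertex of the `i`-th path. -/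
def pathV (p : ℕ) (ℓ : Fin p → ℕ) (i : Fin p) (k : ℕ) : ThetaVert p ℓ :=
  if k = 0 then Sum.inl false
  else if h : k - 1 < ℓ i - 1 then Sum.inr ⟨i, ⟨k - 1, h⟩⟩ else Sum.inl true

lemma pathV_zero (p : ℕ) (ℓ : Fin p → ℕ) (i : Fin p) : pathV p ℓ i 0 = Sum.inl false := by
  unfold pathV
  exact if_pos rfl

lemma pathV_mid (p : ℕ) (ℓ : Fin p → ℕ) (i : Fin p) (k : ℕ) (h : k < ℓ i - 1) :
    pathV p ℓ i (k + 1) = Sum.inr ⟨i, ⟨k, h⟩⟩ := by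
  unfold pathV
  exact (if_neg (Nat.succ_ne_zero k)).trans (dif_pos h)

lemma pathV_end (p : ℕ) (ℓ : Fin p → ℕ) (i : Fin p) (k : ℕ) (hk : ℓ i ≤ k) (h : 1 ≤ k) :
    pathV p ℓ i k = Sum.inl true := by
  unfold pathV
  exact (if_neg (show ¬ k = 0 by omega)).trans (dif_neg (show ¬ (k - 1 < ℓ i - 1) by omega))

lemma pathV_adj (p : ℕ) (ℓ : Fin p → ℕ) (i : Fin p) (k : ℕ) (hk : k < ℓ i) :
    (thetaGraph p ℓ).Adj (pathV p ℓ i k) (pathV p ℓ i (k + 1)) := by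
  rw [thetaGraph, SimpleGraph.fromRel_adj]
  rcases k with _ | k
  · rw [pathV_zero]
    by_cases h1 : 0 < ℓ i - 1
    · rw [pathV_mid p ℓ i 0 h1]
      exact ⟨(fun h => by cases h), Or.inl (Or.inl ⟨rfl, rfl⟩)⟩
    · rw [pathV_end p ℓ i _ (by omega) (by omega)]
      exact ⟨(fun h => by cases h), Or.inl ⟨rfl, rfl, i, by omega⟩⟩
  · rw [pathV_mid p ℓ i k (by omega)]
    by_cases h1 : k + 1 < ℓ i - 1
    · rw [pathV_mid p ℓ i (k + 1) h1]
      refine ⟨?_, Or.inl ⟨rfl, rfl⟩⟩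
      intro h
      have := Sum.inr.inj h
      simp at this
    · rw [pathV_end p ℓ i _ (by omega) (by omega)]
      exact ⟨(fun h => by cases h), Or.inr (Or.inr ⟨rfl, by simp only; omega⟩)⟩

/-- The `k`-th vertex of the cycle formed by paths `i` and `j`. -/
def cycV (p : ℕ) (ℓ : Fin p → ℕ) (i j : Fin p) (k : ℕ) : ThetaVert p ℓ :=
  if k ≤ ℓ i then pathV p ℓ i k else pathV p ℓ j (ℓ i + ℓ j - k)

lemma cycV_adj (p : ℕ) (ℓ : Fin p → ℕ) (hpos : ∀ i, 1 ≤ ℓ i) (i j : Fin p) (k : ℕ)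
    (hk : k < ℓ i + ℓ j) :
    (thetaGraph p ℓ).Adj (cycV p ℓ i j k) (cycV p ℓ i j (k + 1)) := by
  have hi := hpos i
  have hj := hpos j
  unfold cycV
  by_cases h1 : k + 1 ≤ ℓ i
  · rw [if_pos (by omega), if_pos h1]
    exact pathV_adj p ℓ i k h1
  · rw [if_neg h1]
    have e : (if k ≤ ℓ i then pathV p ℓ i k else pathV p ℓ j (ℓ i + ℓ j - k))
        = pathV p ℓ j (ℓ i + ℓ j - k) := by
      split_ifs with h2
      · rw [pathV_end p ℓ i k (by omega) (by omega), pathV_end p ℓ j _ (by omega) (by omega)]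
      · rfl
    rw [e]
    have := pathV_adj p ℓ j (ℓ i + ℓ j - (k + 1)) (by omega)
    rw [show ℓ i + ℓ j - (k + 1) + 1 = ℓ i + ℓ j - k by omega] at this
    exact this.symm

lemma cycV_close (p : ℕ) (ℓ : Fin p → ℕ) (hpos : ∀ i, 1 ≤ ℓ i) (i j : Fin p) :
    cycV p ℓ i j (ℓ i + ℓ j) = cycV p ℓ i j 0 := by
  have hj := hpos j
  unfold cycV
  rw [if_neg (by omega), if_pos (Nat.zero_le _), Nat.sub_self, pathV_zero, pathV_zero]

/-- An index recovering the position on the cycle. -/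
def cycIdx (p : ℕ) (ℓ : Fin p → ℕ) (i j : Fin p) : ThetaVert p ℓ → ℕ
  | Sum.inl false => 0
  | Sum.inl true => ℓ i
  | Sum.inr ⟨a, k⟩ => if a = i then k + 1 else ℓ i + ℓ j - (k + 1)

lemma cycIdx_cycV (p : ℕ) (ℓ : Fin p → ℕ) (hpos : ∀ i, 1 ≤ ℓ i) (i j : Fin p) (hij : i ≠ j)
    (k : ℕ) (hk : k < ℓ i + ℓ j) : cycIdx p ℓ i j (cycV p ℓ i j k) = k := by
  have hi := hpos i
  have hj := hpos j
  unfold cycV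
  split_ifs with h1
  · rcases k with _ | k
    · rw [pathV_zero]; rfl
    · by_cases h2 : k < ℓ i - 1
      · rw [pathV_mid p ℓ i k h2]
        simp [cycIdx]
      · rw [pathV_end p ℓ i _ (by omega) (by omega)]
        simp only [cycIdx]; omega
  · obtain ⟨m, hm⟩ : ∃ m, ℓ i + ℓ j - k = m + 1 := ⟨ℓ i + ℓ j - k - 1, by omega⟩
    rw [hm, pathV_mid p ℓ j m (by omega)]
    simp only [cycIdx, hij.symm, if_false]
    omega

/-- The infinite periodic walk around the cycle. -/
def cycW (p : ℕ) (ℓ : Fin p → ℕ) (i j : Fin p) (t : ℕ) : ThetaVert p ℓ :=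
  cycV p ℓ i j (t % (ℓ i + ℓ j))

lemma cycW_adj (p : ℕ) (ℓ : Fin p → ℕ) (hpos : ∀ i, 1 ≤ ℓ i) (i j : Fin p) (t : ℕ) :
    (thetaGraph p ℓ).Adj (cycW p ℓ i j t) (cycW p ℓ i j (t + 1)) := by
  have hi := hpos i
  have hlt : t % (ℓ i + ℓ j) < ℓ i + ℓ j := Nat.mod_lt _ (by omega)
  have := cycV_adj p ℓ hpos i j _ hlt
  unfold cycW
  by_cases h : t % (ℓ i + ℓ j) + 1 = ℓ i + ℓ j
  · rw [h, cycV_close p ℓ hpos] at this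
    rwa [← Nat.mod_add_mod, h, Nat.mod_self]
  · rwa [← Nat.mod_eq_of_lt (show t % (ℓ i + ℓ j) + 1 < ℓ i + ℓ j by omega), Nat.mod_add_mod] at this

lemma cycW_ne (p : ℕ) (ℓ : Fin p → ℕ) (hpos : ∀ i, 1 ≤ ℓ i) (i j : Fin p) (hij : i ≠ j)
    (t k : ℕ) (h0 : 0 < k) (hk : k < ℓ i + ℓ j) : cycW p ℓ i j t ≠ cycW p ℓ i j (t + k) := by
  intro h
  have h' := congrArg (cycIdx p ℓ i j) h
  unfold cycW at h'
  rw [cycIdx_cycV p ℓ hpos i j hij _ (Nat.mod_lt _ (by omega)),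
    cycIdx_cycV p ℓ hpos i j hij _ (Nat.mod_lt _ (by omega))] at h'
  have h2 : (t + 0) ≡ t + k [MOD (ℓ i + ℓ j)] := h'
  have h3 := Nat.ModEq.add_left_cancel' t h2
  have h4 := (Nat.modEq_zero_iff_dvd.1 h3.symm)
  have := Nat.le_of_dvd h0 h4
  omega

lemma theta_pair (p : ℕ) (ℓ : Fin p → ℕ) (hpos : ∀ i, 1 ≤ ℓ i) (i j : Fin p) (hij : i ≠ j)
    (h4 : 4 ≤ ℓ i + ℓ j) {π : ThetaVert p ℓ → ℕ} (hπ : IsPackingColoring (thetaGraph p ℓ) 3 π) :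
    (ℓ i + ℓ j) % 4 = 0 :=
  three_dvd (w := cycW p ℓ i j) _ hπ (cycW_adj p ℓ hpos i j)
    (fun t => cycW_ne p ℓ hpos i j hij t 2 (by omega) (by omega))
    (fun t => cycW_ne p ℓ hpos i j hij t 3 (by omega) (by omega))
    (fun t => by simp [cycW])

lemma not_adj_of_color_one {V : Type*} {G : SimpleGraph V} {x y : V} (hne : x ≠ y)
    (h : ¬ G.Adj x y) : ((1 : ℕ) : ℕ∞) < G.edist x y := by
  by_contra hlt
  push Not at hlt
  have h2 : G.edist x y ≠ 0 := by simpa [SimpleGraph.edist_eq_zero_iff] using hne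
  have h3 : G.edist x y = 1 := le_antisymm (by simpa using hlt) (Order.one_le_iff_ne_zero.2 h2)
  exact h (SimpleGraph.edist_eq_one_iff_adj.1 h3)

/-- A map to the 4-cycle, locally injective at odd vertices, yields a packing 3-coloring. -/
lemma color_of_hom {V : Type*} {G : SimpleGraph V} (h : V → ℕ) (hlt : ∀ x, h x < 4)
    (hadj : ∀ x y, G.Adj x y → (h x + 1) % 4 = h y ∨ (h y + 1) % 4 = h x)
    (hinj : ∀ z x y, h z % 2 = 1 → G.Adj z x → G.Adj z y → h x = h y → x = y) :
    ∃ π : V → ℕ, IsPackingColoring G 3 π := by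
  refine ⟨fun x => if h x % 2 = 1 then 1 else if h x = 0 then 2 else 3, ?_, ?_⟩
  · intro x; dsimp only; split_ifs <;> omega
  · intro x y hne hc
    have hx := hlt x
    have hy := hlt y
    dsimp only at hc ⊢
    by_cases hodd : h x % 2 = 1
    · rw [if_pos hodd] at hc ⊢
      apply not_adj_of_color_one hne
      intro ha
      have := hadj x y ha
      split_ifs at hc <;> omega
    · have hxy : h x = h y := by split_ifs at hc <;> omega
      have hle : (if h x % 2 = 1 then 1 else if h x = 0 then 2 else 3) ≤ 3 := by
        split_ifs <;> omega
      refine lt_of_le_of_lt (Nat.cast_le.2 hle) ?_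
      by_contra hcon
      push Not at hcon
      have hnt : G.edist x y ≠ ⊤ := ne_top_of_le_ne_top (by simp) hcon
      obtain ⟨W, hW⟩ := SimpleGraph.exists_walk_of_edist_ne_top hnt
      rw [← hW] at hcon
      have hlen : W.length ≤ 3 := by exact_mod_cast hcon
      clear hW hcon hnt
      cases W with
      | nil => exact hne rfl
      | cons a1 W =>
        cases W with
        | nil => have := hadj _ _ a1; omega
        | cons a2 W =>
          cases W with
          | nil =>
            have := hadj _ _ a1
            exact hne (hinj _ _ _ (by omega) a1.symm a2 hxy)
          | cons a3 W =>
            cases W with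
            | nil =>
              have := hadj _ _ a1; have := hadj _ _ a2; have := hadj _ _ a3
              omega
            | cons a4 W => simp at hlen; omega

/-- The map to the 4-cycle. -/
def hmap (p : ℕ) (ℓ : Fin p → ℕ) (hp : 2 ≤ p) : ThetaVert p ℓ → ℕ
  | Sum.inl false => 0
  | Sum.inl true => ℓ ⟨0, by omega⟩ % 4
  | Sum.inr ⟨i, k⟩ => if (i : ℕ) = 0 then (k + 1) % 4 else (3 * (k + 1)) % 4

lemma hmap_rel (p : ℕ) (ℓ : Fin p → ℕ) (hp : 2 ≤ p)
    (h4 : ∀ j : Fin p, 0 < (j : ℕ) → (ℓ ⟨0, by omega⟩ + ℓ j) % 4 = 0)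
    (hsimple : ∀ j : Fin p, 0 < (j : ℕ) → 2 ≤ ℓ j)
    (x y : ThetaVert p ℓ) (hr : thetaRel p ℓ x y) :
    (hmap p ℓ hp x + 1) % 4 = hmap p ℓ hp y ∨ (hmap p ℓ hp y + 1) % 4 = hmap p ℓ hp x := by
  rcases x with a | ⟨i, k⟩ <;> rcases y with b | ⟨i', k'⟩
  · obtain ⟨rfl, rfl, i, hi⟩ := hr
    have : (i : ℕ) = 0 := by
      by_contra h
      have := hsimple i (by omega)
      omega
    obtain rfl : i = ⟨0, (show 0 < p from lt_of_lt_of_le Nat.zero_lt_two hp)⟩ := Fin.ext this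
    simp [hmap, hi]
  · rcases hr with ⟨rfl, h⟩ | ⟨rfl, h⟩
    · simp only [hmap, h]; split_ifs <;> simp
    · by_cases h0 : (i' : ℕ) = 0
      · obtain rfl : i' = ⟨0, (show 0 < p from lt_of_lt_of_le Nat.zero_lt_two hp)⟩ := Fin.ext h0
        simp only [hmap, if_true]
        omega
      · have := h4 i' (by omega)
        simp only [hmap, h0, if_false]
        omega
  · exact hr.elim
  · obtain ⟨h1, h2⟩ := hr
    simp only [hmap, h1]
    split_ifs <;> omega

lemma hmap_inj (p : ℕ) (ℓ : Fin p → ℕ) (hp : 2 ≤ p) (hpos : ∀ i, 1 ≤ ℓ i)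
    (h4 : ∀ i j : Fin p, i < j → (ℓ i + ℓ j) % 4 = 0)
    (hsimple : ∀ j : Fin p, 0 < (j : ℕ) → 2 ≤ ℓ j)
    (z x y : ThetaVert p ℓ) (hz : hmap p ℓ hp z % 2 = 1)
    (hx : thetaRel p ℓ z x ∨ thetaRel p ℓ x z) (hy : thetaRel p ℓ z y ∨ thetaRel p ℓ y z)
    (hxy : hmap p ℓ hp x = hmap p ℓ hp y) : x = y := by
  have h04 : ∀ j : Fin p, 0 < (j : ℕ) → (ℓ ⟨0, by omega⟩ + ℓ j) % 4 = 0 :=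
    fun j hj => h4 _ _ (by simpa [Fin.lt_def] using hj)
  rcases z with (_ | _) | ⟨i, k⟩
  · simp [hmap] at hz
  · -- the end-vertex `v`
    have hodd : ℓ ⟨0, by omega⟩ % 2 = 1 := by simp only [hmap] at hz; omega
    have hp2 : p = 2 := by
      by_contra hne
      have a := h04 ⟨1, by omega⟩ (by simp)
      have b := h04 ⟨2, by omega⟩ (by simp)
      have c := h4 ⟨1, by omega⟩ ⟨2, by omega⟩ (by simp [Fin.lt_def])
      omega
    have nb : ∀ x : ThetaVert p ℓ, thetaRel p ℓ (Sum.inl true) x ∨ thetaRel p ℓ x (Sum.inl true) →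
        (ℓ ⟨0, by omega⟩ = 1 ∧ x = Sum.inl false) ∨
        ∃ (i : Fin p) (k : Fin (ℓ i - 1)), x = Sum.inr ⟨i, k⟩ ∧ (k : ℕ) + 2 = ℓ i := by
      intro x hx
      rcases x with b | ⟨i, k⟩
      · rcases hx with hx | hx
        · simp [thetaRel] at hx
        · obtain ⟨rfl, -, i, hi⟩ := hx
          left
          have : (i : ℕ) = 0 := by
            by_contra h
            have := hsimple i (by omega)
            omega
          obtain rfl : i = ⟨0, (show 0 < p from lt_of_lt_of_le Nat.zero_lt_two hp)⟩ := Fin.ext this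
          exact ⟨hi, rfl⟩
      · rcases hx with hx | hx
        · right
          refine ⟨i, k, rfl, ?_⟩
          simpa [thetaRel] using hx
        · exact hx.elim
    rcases nb x hx with ⟨hl, rfl⟩ | ⟨i, k, rfl, hk⟩ <;>
      rcases nb y hy with ⟨hl', rfl⟩ | ⟨i', k', rfl, hk'⟩
    · rfl
    · exfalso
      have a := h04 i'
      by_cases h0 : (i' : ℕ) = 0
      · obtain rfl : i' = ⟨0, (show 0 < p from lt_of_lt_of_le Nat.zero_lt_two hp)⟩ := Fin.ext h0
        omega
      · simp only [hmap, h0, if_false] at hxy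
        omega
    · exfalso
      have a := h04 i
      by_cases h0 : (i : ℕ) = 0
      · obtain rfl : i = ⟨0, (show 0 < p from lt_of_lt_of_le Nat.zero_lt_two hp)⟩ := Fin.ext h0
        omega
      · simp only [hmap, h0, if_false] at hxy
        omega
    · have hi : (i : ℕ) = i' := by
        have a := h04 i
        have a' := h04 i'
        by_contra hne
        by_cases h0 : (i : ℕ) = 0
        · obtain rfl : i = ⟨0, (show 0 < p from lt_of_lt_of_le Nat.zero_lt_two hp)⟩ := Fin.ext h0
          have h1 : (i' : ℕ) ≠ 0 := by omega
          simp only [hmap, h1, if_false, if_true] at hxy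
          omega
        · by_cases h1 : (i' : ℕ) = 0
          · obtain rfl : i' = ⟨0, (show 0 < p from lt_of_lt_of_le Nat.zero_lt_two hp)⟩ := Fin.ext h1
            simp only [hmap, h0, if_false, if_true] at hxy
            omega
          · omega
      obtain rfl : i = i' := Fin.ext hi
      obtain rfl : k = k' := Fin.ext (by omega)
      rfl
  · -- an internal vertex: its neighbours are the previous and the next one on the path
    have nb : ∀ x : ThetaVert p ℓ,
        thetaRel p ℓ (Sum.inr ⟨i, k⟩) x ∨ thetaRel p ℓ x (Sum.inr ⟨i, k⟩) →
        (x = pathV p ℓ i k ∧ hmap p ℓ hp x =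
          (if (i : ℕ) = 0 then (k : ℕ) % 4 else (3 * k) % 4)) ∨
        (x = pathV p ℓ i (k + 2) ∧ hmap p ℓ hp x =
          (if (i : ℕ) = 0 then ((k : ℕ) + 2) % 4 else (3 * (k + 2)) % 4)) := by
      intro x hx
      have hk := k.isLt
      rcases x with b | ⟨i', k'⟩
      · rcases hx with hx | hx
        · exact hx.elim
        · rcases hx with ⟨rfl, h⟩ | ⟨rfl, h⟩
          · left
            rw [h, pathV_zero]
            exact ⟨rfl, by simp [hmap]⟩
          · right
            refine ⟨(pathV_end p ℓ i _ (by omega) (by omega)).symm, ?_⟩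
            by_cases h0 : (i : ℕ) = 0
            · obtain rfl : i = ⟨0, (show 0 < p from lt_of_lt_of_le Nat.zero_lt_two hp)⟩ := Fin.ext h0
              simp only [hmap, if_true, h]
            · have := h04 i (by omega)
              simp only [hmap, h0, if_false]
              omega
      · rcases hx with ⟨h1, h2⟩ | ⟨h1, h2⟩
        · obtain rfl : i = i' := Fin.ext h1
          right
          have hk' := k'.isLt
          constructor
          · rw [pathV_mid p ℓ i (k + 1) (by omega)]
            have e : k' = ⟨(k : ℕ) + 1, h2 ▸ hk'⟩ := Fin.ext h2.symm
            exact congrArg (fun q => (Sum.inr ⟨i, q⟩ : ThetaVert p ℓ)) e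
          · simp only [hmap]; split_ifs <;> omega
        · obtain rfl : i' = i := Fin.ext h1
          left
          have hk' := k'.isLt
          constructor
          · rw [← h2, pathV_mid p ℓ i' k' hk']
          · simp only [hmap]; split_ifs <;> omega
    rcases nb x hx with ⟨e, f⟩ | ⟨e, f⟩ <;> rcases nb y hy with ⟨e', f'⟩ | ⟨e', f'⟩
    · rw [e, e']
    · exfalso; split_ifs at f f' <;> omega
    · exfalso; split_ifs at f f' <;> omega
    · rw [e, e']

theorem stmt3 (p : ℕ) (ℓ : Fin p → ℕ) (hp : 2 ≤ p)
    (hmono : Monotone ℓ) (hpos : ∀ i, 1 ≤ ℓ i) (hsimple : 2 ≤ ℓ ⟨1, by omega⟩) :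
    packingChromaticNumber (thetaGraph p ℓ) = 3 ↔
      ((ℓ ⟨0, by omega⟩ = 1 ∧ ∀ i : Fin p, 0 < (i : ℕ) → ℓ i = 2) ∨
       (∀ i j : Fin p, i < j → (ℓ i + ℓ j) % 4 = 0)) := by
  have hs : ∀ j : Fin p, 0 < (j : ℕ) → 2 ≤ ℓ j := fun j hj =>
    hsimple.trans (hmono (by rw [Fin.le_def]; exact hj))
  have hp0 := hpos ⟨0, by omega⟩
  constructor
  · intro h
    obtain ⟨π, hπ⟩ : ∃ π, IsPackingColoring (thetaGraph p ℓ) 3 π := by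
      have hne : {k | ∃ π, IsPackingColoring (thetaGraph p ℓ) k π}.Nonempty := by
        apply Nat.nonempty_of_pos_sInf
        unfold packingChromaticNumber at h
        omega
      have := Nat.sInf_mem hne
      unfold packingChromaticNumber at h
      rw [h] at this
      exact this
    have hpair := fun i j hij h4 => theta_pair p ℓ hpos i j hij h4 hπ
    have hpos4 : ∀ i j : Fin p, 0 < (i : ℕ) → i < j → (ℓ i + ℓ j) % 4 = 0 := by
      intro i j hi hij
      have := hs i hi
      have := hs j (by rw [Fin.lt_def] at hij; omega)
      exact hpair i j hij.ne (by omega)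
    by_cases h1 : ℓ ⟨0, by omega⟩ = 1
    · by_cases h2 : ∀ i : Fin p, 0 < (i : ℕ) → ℓ i = 2
      · exact Or.inl ⟨h1, h2⟩
      · right
        push Not at h2
        obtain ⟨a, ha, hla⟩ := h2
        have q0 : ∀ j : Fin p, 0 < (j : ℕ) → ℓ j = 2 ∨ ℓ j % 4 = 3 := by
          intro j hj
          have := hs j hj
          by_cases hj2 : ℓ j = 2
          · exact Or.inl hj2
          · have := hpair ⟨0, by omega⟩ j (by intro h; rw [← h] at hj; simp at hj) (by omega)
            omega
        have uniq : ∀ j : Fin p, 0 < (j : ℕ) → j = a := by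
          intro j hj
          have ea := q0 a ha
          have ej := q0 j hj
          rcases lt_trichotomy j a with hlt | he | hlt
          · have := hpos4 j a hj hlt
            omega
          · exact he
          · have := hpos4 a j ha hlt
            omega
        intro i j hij
        have hij' := hij
        rw [Fin.lt_def] at hij
        have hj := uniq j (by omega)
        have hi : (i : ℕ) = 0 := by
          by_contra hne
          have := uniq i (by omega)
          subst this; subst hj; omega
        obtain rfl : i = ⟨0, (show 0 < p from lt_of_lt_of_le Nat.zero_lt_two hp)⟩ := Fin.ext hi
        subst hj
        have := q0 j ha
        omega
    · right
      intro i j hij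
      by_cases hi : (i : ℕ) = 0
      · obtain rfl : i = ⟨0, (show 0 < p from lt_of_lt_of_le Nat.zero_lt_two hp)⟩ := Fin.ext hi
        have := hs j (by rw [Fin.lt_def] at hij; exact hij)
        exact hpair _ j hij.ne (by omega)
      · exact hpos4 i j (by omega) hij
  · intro h
    have hex : ∃ π, IsPackingColoring (thetaGraph p ℓ) 3 π := by
      rcases h with ⟨h1, h2⟩ | h
      · refine ⟨fun x => match x with
          | Sum.inl false => 2
          | Sum.inl true => 3
          | Sum.inr _ => 1, ?_, ?_⟩
        · rintro ((_ | _) | _) <;> simp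
        · have hle : ∀ i, ℓ i ≤ 2 := by
            intro i
            by_cases hi : (i : ℕ) = 0
            · obtain rfl : i = ⟨0, (show 0 < p from lt_of_lt_of_le Nat.zero_lt_two hp)⟩ := Fin.ext hi
              omega
            · exact (h2 i (by omega)).le
          rintro ((_ | _) | ⟨i, k⟩) ((_ | _) | ⟨i', k'⟩) hne hc <;>
            first
            | exact absurd rfl hne
            | (simp at hc; done)
            | skip
          apply not_adj_of_color_one hne
          intro ha
          have ha := (SimpleGraph.fromRel_adj (thetaRel p ℓ) _ _).1 ha
          have := k.isLt
          have := k'.isLt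
          have := hle i
          have := hle i'
          rcases ha.2 with ⟨_, h⟩ | ⟨_, h⟩ <;> omega
      · have h04 : ∀ j : Fin p, 0 < (j : ℕ) → (ℓ ⟨0, by omega⟩ + ℓ j) % 4 = 0 :=
          fun j hj => h _ _ (by simpa [Fin.lt_def] using hj)
        apply color_of_hom (hmap p ℓ hp)
        · rintro ((_ | _) | ⟨i, k⟩) <;> simp only [hmap]
          · omega
          · omega
          · split_ifs <;> omega
        · intro x y ha
          rw [thetaGraph, SimpleGraph.fromRel_adj] at ha
          rcases ha.2 with h' | h'
          · exact hmap_rel p ℓ hp h04 hs x y h'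
          · exact (hmap_rel p ℓ hp h04 hs y x h').symm
        · intro z x y hz hx hy hxy
          rw [thetaGraph, SimpleGraph.fromRel_adj] at hx hy
          exact hmap_inj p ℓ hp hpos h hs z x y hz hx.2 hy.2 hxy
    have hne : {k | ∃ π, IsPackingColoring (thetaGraph p ℓ) k π}.Nonempty := ⟨3, hex⟩
    refine le_antisymm (Nat.sInf_le hex) ?_
    by_contra hlt
    obtain ⟨π, hπ⟩ := Nat.sInf_mem hne
    have h01 : (⟨0, by omega⟩ : Fin p) ≠ ⟨1, by omega⟩ := by simp
    refine no_two (w := cycW p ℓ ⟨0, by omega⟩ ⟨1, by omega⟩) ?_ hπ (cycW_adj p ℓ hpos _ _)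
      (fun t => cycW_ne p ℓ hpos _ _ h01 t 2 (by omega) (by omega))
    unfold packingChromaticNumber at hlt
    omega
end

section
/- Let Θ = Θ_{ℓ1,…,ℓp} be a generalized theta graph with p ≥ 3. There exists a packing 4-coloring π of Θ with π(u) = π(v) = 4 if and only if n_1 = n_2 = n_3 = n_4 = 0. -/
/-- A 1-Lipschitz function bounds the length of walks from below. -/
theorem lip_walk {V : Type*} (G : SimpleGraph V) (f : V → ℕ)
    (hf : ∀ x y, G.Adj x y → f y ≤ f x + 1) {x y : V} (w : G.Walk x y) :
    f y ≤ f x + w.length := by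
  induction w with
  | nil => simp
  | cons h w ih =>
    have := hf _ _ h
    simp only [SimpleGraph.Walk.length_cons]
    omega

theorem lip_edist {V : Type*} (G : SimpleGraph V) (f : V → ℕ)
    (hf : ∀ x y, G.Adj x y → f y ≤ f x + 1) {x y : V} (n : ℕ) (h : f x + n < f y) :
    (n : ℕ∞) < G.edist x y := by
  by_contra hc
  have hc : G.edist x y ≤ n := not_lt.mp hc
  have hne : G.edist x y ≠ ⊤ := ne_top_of_le_ne_top (ENat.natCast_ne_top n) hc
  obtain ⟨w, hw⟩ := SimpleGraph.exists_walk_of_edist_ne_top hne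
  have := lip_walk G f hf w
  rw [← hw] at hc
  have : w.length ≤ n := by exact_mod_cast hc
  omega

/-- Color of the internal vertex at position `k` of a path of length `l`. -/
def pathColor (l k : ℕ) : ℕ :=
  if l % 2 = 0 then (if k % 2 = 1 then 1 else if k % 4 = 2 then 2 else 3)
  else if k = 1 then 1 else if k = 2 then 2 else if k % 2 = 0 then 1
  else if k % 4 = 3 then 3 else 2

def thetaColor (p : ℕ) (ℓ : Fin p → ℕ) : ThetaVert p ℓ → ℕ
  | Sum.inl _ => 4
  | Sum.inr ⟨i, j⟩ => pathColor (ℓ i) (j + 1)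

/-- Lower bound for the distance from an internal vertex, truncated at five. -/
def lowDist (p : ℕ) (ℓ : Fin p → ℕ) (i : Fin p) (a : ℕ) : ThetaVert p ℓ → ℕ
  | Sum.inl false => min 5 a
  | Sum.inl true => min 5 (ℓ i - a)
  | Sum.inr ⟨i', j⟩ =>
    if i = i' then min 5 ((a - (j + 1)) + ((j + 1) - a))
    else min 5 (min (a + (j + 1)) ((ℓ i - a) + (ℓ i' - (j + 1))))

/-- Lower bound for the distance from `u`, truncated at five. -/
def lowDistU (p : ℕ) (ℓ : Fin p → ℕ) : ThetaVert p ℓ → ℕ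
  | Sum.inl false => 0
  | Sum.inl true => 5
  | Sum.inr ⟨i, j⟩ => min 5 (min (j + 1) (5 + ℓ i - (j + 1)))

theorem lip_of_rel (p : ℕ) (ℓ : Fin p → ℕ) (f : ThetaVert p ℓ → ℕ)
    (h : ∀ x y, thetaRel p ℓ x y → f y ≤ f x + 1 ∧ f x ≤ f y + 1) :
    ∀ x y, (thetaGraph p ℓ).Adj x y → f y ≤ f x + 1 := by
  intro x y hxy
  rw [thetaGraph, SimpleGraph.fromRel_adj] at hxy
  rcases hxy.2 with h1 | h1
  · exact (h _ _ h1).1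
  · exact (h _ _ h1).2

theorem lowDist_lip (p : ℕ) (ℓ : Fin p → ℕ) (h5 : ∀ i, 5 ≤ ℓ i) (i : Fin p) (a : ℕ)
    (ha : a ≤ ℓ i) :
    ∀ x y, (thetaGraph p ℓ).Adj x y → lowDist p ℓ i a y ≤ lowDist p ℓ i a x + 1 := by
  apply lip_of_rel
  have hi := h5 i
  rintro (b | ⟨i1, j1, hj1⟩) (c | ⟨i2, j2, hj2⟩) hr
  · obtain ⟨-, -, k, hk⟩ := hr
    have := h5 k
    omega
  · have h2 := h5 i2
    have hr : (b = false ∧ j2 = 0) ∨ (b = true ∧ j2 + 2 = ℓ i2) := hr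
    rcases hr with ⟨rfl, h⟩ | ⟨rfl, h⟩ <;> simp only [lowDist] <;> split_ifs with he <;>
      first
      | (subst he; omega)
      | omega
  · exact hr.elim
  · have hr : (i1 : ℕ) = (i2 : ℕ) ∧ j1 + 1 = j2 := hr
    obtain ⟨h1, h2⟩ := hr
    have := Fin.ext h1
    subst this
    simp only [lowDist]
    split_ifs <;> omega

theorem lowDistU_lip (p : ℕ) (ℓ : Fin p → ℕ) (h5 : ∀ i, 5 ≤ ℓ i) :
    ∀ x y, (thetaGraph p ℓ).Adj x y → lowDistU p ℓ y ≤ lowDistU p ℓ x + 1 := by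
  apply lip_of_rel
  rintro (b | ⟨i1, j1, hj1⟩) (c | ⟨i2, j2, hj2⟩) hr
  · obtain ⟨-, -, k, hk⟩ := hr
    have := h5 k
    omega
  · have h2 := h5 i2
    have hr : (b = false ∧ j2 = 0) ∨ (b = true ∧ j2 + 2 = ℓ i2) := hr
    rcases hr with ⟨rfl, h⟩ | ⟨rfl, h⟩ <;> simp only [lowDistU] <;> omega
  · exact hr.elim
  · have hr : (i1 : ℕ) = (i2 : ℕ) ∧ j1 + 1 = j2 := hr
    obtain ⟨h1, h2⟩ := hr
    have := Fin.ext h1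
    subst this
    simp only [lowDistU]
    omega

theorem pathColor_bounds (l k : ℕ) : 1 ≤ pathColor l k ∧ pathColor l k ≤ 3 := by
  unfold pathColor
  split_ifs <;> omega

theorem pathColor_same (l a b : ℕ) (ha : 1 ≤ a) (hb : 1 ≤ b) (hab : a ≠ b)
    (h : pathColor l a = pathColor l b) : pathColor l a < (a - b) + (b - a) := by
  unfold pathColor at *
  split_ifs at * <;> omega

theorem pathColor_left (l a : ℕ) (ha : 1 ≤ a) (h : pathColor l a ≠ 1) : 2 ≤ a := by
  unfold pathColor at *
  split_ifs at * <;> omega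

theorem pathColor_right (l a : ℕ) (hl : 5 ≤ l) (ha : a < l) (h : pathColor l a ≠ 1) :
    a + 2 ≤ l := by
  unfold pathColor at *
  split_ifs at * <;> omega

theorem thetaColor_packing (p : ℕ) (ℓ : Fin p → ℕ) (h5 : ∀ i, 5 ≤ ℓ i) :
    IsPackingColoring (thetaGraph p ℓ) 4 (thetaColor p ℓ) := by
  constructor
  · rintro (b | ⟨i, j⟩)
    · simp [thetaColor]
    · have := pathColor_bounds (ℓ i) (j + 1)
      simp only [thetaColor]
      omega
  · have huv : ((4 : ℕ) : ℕ∞) < (thetaGraph p ℓ).edist (Sum.inl false) (Sum.inl true) :=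
      lip_edist _ _ (lowDistU_lip p ℓ h5) 4 (by simp [lowDistU])
    rintro (b | ⟨i1, j1, hj1⟩) (c | ⟨i2, j2, hj2⟩) hne heq
    · cases b <;> cases c
      · exact absurd rfl hne
      · exact huv
      · exact lt_of_lt_of_eq huv SimpleGraph.edist_comm
      · exact absurd rfl hne
    · have := pathColor_bounds (ℓ i2) (j2 + 1)
      simp only [thetaColor] at heq
      omega
    · have := pathColor_bounds (ℓ i1) (j1 + 1)
      simp only [thetaColor] at heq
      omega
    · simp only [thetaColor] at heq ⊢
      apply lip_edist _ _ (lowDist_lip p ℓ h5 i1 (j1 + 1) (by omega))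
      have hb1 := pathColor_bounds (ℓ i1) (j1 + 1)
      simp only [lowDist, if_true]
      split_ifs with he
      · subst he
        have hjne : j1 + 1 ≠ j2 + 1 := by
          intro h
          have : j1 = j2 := by omega
          subst this
          exact hne rfl
        have := pathColor_same _ _ _ (by omega) (by omega) hjne heq
        omega
      · have l1 := pathColor_left (ℓ i1) (j1 + 1) (by omega)
        have l2 := pathColor_left (ℓ i2) (j2 + 1) (by omega)
        have r1 := pathColor_right (ℓ i1) (j1 + 1) (h5 _) (by omega)
        have r2 := pathColor_right (ℓ i2) (j2 + 1) (h5 _) (by omega)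
        rw [← heq] at l2 r2
        by_cases hc : pathColor (ℓ i1) (j1 + 1) = 1
        · omega
        · have := l1 hc
          have := l2 hc
          have := r1 hc
          have := r2 hc
          omega

theorem edist_internal (p : ℕ) (ℓ : Fin p → ℕ) (i : Fin p) (j : ℕ) (hj : j < ℓ i - 1) :
    (thetaGraph p ℓ).edist (Sum.inl false) (Sum.inr ⟨i, ⟨j, hj⟩⟩) ≤ ((j + 1 : ℕ) : ℕ∞) := by
  induction j with
  | zero =>
    have hadj : (thetaGraph p ℓ).Adj (Sum.inl false) (Sum.inr ⟨i, ⟨0, hj⟩⟩) := by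
      refine (SimpleGraph.fromRel_adj _ _ _).mpr ?_
      exact ⟨Sum.inl_ne_inr, Or.inl (Or.inl ⟨rfl, rfl⟩)⟩
    simpa using (SimpleGraph.edist_eq_one_iff_adj.mpr hadj).le
  | succ j ih =>
    have hj' : j < ℓ i - 1 := by omega
    have hadj : (thetaGraph p ℓ).Adj (Sum.inr ⟨i, ⟨j, hj'⟩⟩) (Sum.inr ⟨i, ⟨j + 1, hj⟩⟩) := by
      refine (SimpleGraph.fromRel_adj _ _ _).mpr ?_
      refine ⟨?_, Or.inl ⟨rfl, rfl⟩⟩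
      intro h
      have h := Sum.inr.inj h
      simp at h
    calc _ ≤ _ := SimpleGraph.edist_triangle (v := (Sum.inr ⟨i, ⟨j, hj'⟩⟩ : ThetaVert p ℓ))
      _ ≤ ((j + 1 : ℕ) : ℕ∞) + 1 :=
        add_le_add (ih hj') (SimpleGraph.edist_eq_one_iff_adj.mpr hadj).le
      _ = _ := by push_cast; rfl

theorem edist_ends (p : ℕ) (ℓ : Fin p → ℕ) (i : Fin p) (hi : 1 ≤ ℓ i) :
    (thetaGraph p ℓ).edist (Sum.inl false) (Sum.inl true) ≤ ((ℓ i : ℕ) : ℕ∞) := by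
  by_cases h1 : ℓ i = 1
  · have hadj : (thetaGraph p ℓ).Adj (Sum.inl false) (Sum.inl true) := by
      refine (SimpleGraph.fromRel_adj _ _ _).mpr ?_
      exact ⟨(fun h => by cases Sum.inl.inj h), Or.inl ⟨rfl, rfl, i, h1⟩⟩
    rw [h1]
    simpa using (SimpleGraph.edist_eq_one_iff_adj.mpr hadj).le
  · have hj : ℓ i - 2 < ℓ i - 1 := by omega
    have hadj : (thetaGraph p ℓ).Adj (Sum.inr ⟨i, ⟨ℓ i - 2, hj⟩⟩) (Sum.inl true) := by
      refine (SimpleGraph.fromRel_adj _ _ _).mpr ?_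
      refine ⟨Sum.inr_ne_inl, Or.inr (Or.inr ⟨rfl, ?_⟩)⟩
      show ℓ i - 2 + 2 = ℓ i
      omega
    calc _ ≤ _ := SimpleGraph.edist_triangle (v := (Sum.inr ⟨i, ⟨ℓ i - 2, hj⟩⟩ : ThetaVert p ℓ))
      _ ≤ ((ℓ i - 2 + 1 : ℕ) : ℕ∞) + 1 :=
        add_le_add (edist_internal p ℓ i _ hj) (SimpleGraph.edist_eq_one_iff_adj.mpr hadj).le
      _ = ((ℓ i - 2 + 1 + 1 : ℕ) : ℕ∞) := by push_cast; rfl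
      _ = _ := by congr 1; omega

theorem pathCount_zero (p : ℕ) (ℓ : Fin p → ℕ) (m : ℕ) :
    pathCount p ℓ m = 0 ↔ ∀ i, ℓ i ≠ m := by
  simp [pathCount, Finset.filter_eq_empty_iff]


theorem stmt4 (p : ℕ) (ℓ : Fin p → ℕ) (hp : 3 ≤ p)
    (hmono : Monotone ℓ) (hpos : ∀ i, 1 ≤ ℓ i) (hsimple : 2 ≤ ℓ ⟨1, by omega⟩) :
    (∃ π : ThetaVert p ℓ → ℕ, IsPackingColoring (thetaGraph p ℓ) 4 π ∧ π (thetaU p ℓ) = 4 ∧ π (thetaV p ℓ) = 4) ↔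
      (pathCount p ℓ 1 = 0 ∧ pathCount p ℓ 2 = 0 ∧ pathCount p ℓ 3 = 0 ∧ pathCount p ℓ 4 = 0) := by
  simp only [pathCount_zero]
  constructor
  · rintro ⟨π, ⟨-, hπ⟩, hu, hv⟩
    have huv := hπ (thetaU p ℓ) (thetaV p ℓ) (fun h => by cases Sum.inl.inj h) (by rw [hu, hv])
    rw [hu] at huv
    have key : ∀ i, 4 < ℓ i := fun i => by
      have := lt_of_lt_of_le huv (edist_ends p ℓ i (hpos i))
      exact_mod_cast this
    refine ⟨?_, ?_, ?_, ?_⟩ <;> intro i <;> have := key i <;> omega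
  · rintro ⟨h1, h2, h3, h4⟩
    refine ⟨thetaColor p ℓ, thetaColor_packing p ℓ ?_, rfl, rfl⟩
    intro i
    have := hpos i
    have := h1 i
    have := h2 i
    have := h3 i
    have := h4 i
    omega
end
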